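/- There exists a subset S ⊆ [0, 1/2] of full Lebesgue measure (i.e. the Lebesgue measure of [0,1/2] \ S is zero) such that for every α ∈ S, as Q → ∞ through the positive integers, (1/#F(Q)) · Σ_{x ∈ F_α(Q)} s(x) = (1/12) log Q + o(log Q); that is, ((1/#F(Q)) · Σ_{x ∈ F_α(Q)} s(x) − (1/12) log Q) / log Q tends to 0 as Q → ∞. -/

import Mathlib

open Classical in
/-- The sawtooth function `((x))`: `x - ⌊x⌋ - 1/2` for non-integral `x`, and `0` on `ℤ`. -/
noncomputable def saw (x : ℝ) : ℝ := if Int.fract x = 0 then 0 else Int.fract x - 1/2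

/-- The Dedekind sum `s(a,b) = ∑_{n=1}^{b} ((n/b))·((na/b))`. -/
noncomputable def dedekindSum (a b : ℤ) : ℝ :=
  ∑ n ∈ Finset.Icc 1 b.toNat, saw ((n : ℝ) / (b : ℝ)) * saw ((n : ℝ) * (a : ℝ) / (b : ℝ))

/-- The Dedekind sum of a rational number `x = a/b` (in lowest terms), `s(x) = s(a,b)`. -/
noncomputable def sQ (x : ℚ) : ℝ := dedekindSum x.num x.den
/-- The Farey fractions of order `Q`: rationals in `[0,1]` with denominator at most `Q`. -/
def farey (Q : ℕ) : Finset ℚ :=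
  (Finset.Icc 1 Q).biUnion fun w => (Finset.Icc 0 w).image fun v : ℕ => (v : ℚ) / (w : ℚ)

/-- cotangent of `π x`, zero at integers -/
noncomputable def ct (x : ℝ) : ℝ := Real.cos (Real.pi * x) / Real.sin (Real.pi * x)

theorem ct_int (m : ℤ) : ct m = 0 := by
  unfold ct
  rw [mul_comm, Real.sin_int_mul_pi]; simp

theorem ct_add_int (x : ℝ) (m : ℤ) : ct (x + m) = ct x := by
  unfold ct
  rw [mul_add, mul_comm Real.pi (m:ℝ), Real.cos_add_int_mul_pi, Real.sin_add_int_mul_pi]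
  rcases Int.even_or_odd m with h | h
  · rw [h.neg_one_zpow]; simp
  · rw [h.neg_one_zpow]; simp

theorem ct_neg (x : ℝ) : ct (-x) = - ct x := by
  unfold ct
  rw [mul_neg, Real.cos_neg, Real.sin_neg, div_neg]

theorem saw_add_int (x : ℝ) (m : ℤ) : saw (x + m) = saw x := by
  unfold saw; simp

theorem saw_zero : saw 0 = 0 := by unfold saw; simp

theorem saw_neg (x : ℝ) : saw (-x) = - saw x := by
  unfold saw
  by_cases h : Int.fract x = 0
  · rw [if_pos h, if_pos (Int.fract_neg_eq_zero.2 h)]; simp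
  · rw [if_neg h, if_neg (fun h' => h (Int.fract_neg_eq_zero.1 h')), Int.fract_neg h]; ring

theorem saw_lt {k w : ℕ} (hk : 0 < k) (h : k < w) : saw ((k:ℝ)/w) = (k:ℝ)/w - 1/2 := by
  unfold saw
  have hw : (0:ℝ) < w := by exact_mod_cast (by omega : 0 < w)
  have h1 : Int.fract ((k:ℝ)/w) = (k:ℝ)/w := by
    rw [Int.fract_eq_self]
    refine ⟨by positivity, ?_⟩
    rw [div_lt_one hw]; exact_mod_cast h
  rw [h1, if_neg]
  have : (0:ℝ) < k := by exact_mod_cast hk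
  positivity

theorem sum_sin_aux (t : ℝ) (N : ℕ) :
    (∑ k ∈ Finset.range N, Real.sin (k * (2*t))) * (2 * Real.sin t) =
      Real.cos t - Real.cos ((2*N-1) * t) := by
  induction N with
  | zero => simp
  | succ N ih =>
    rw [Finset.sum_range_succ, add_mul, ih]
    push_cast
    have e1 : (2*((N:ℝ)+1)-1)*t = N*(2*t) + t := by ring
    have e2 : (2*(N:ℝ)-1)*t = N*(2*t) - t := by ring
    rw [e1, e2, Real.cos_add, Real.cos_sub]; ring

theorem sum_cos_aux (t : ℝ) (N : ℕ) :
    (∑ k ∈ Finset.range N, Real.cos (k * (2*t))) * (2 * Real.sin t) =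
      Real.sin t + Real.sin ((2*N-1) * t) := by
  induction N with
  | zero => simp
  | succ N ih =>
    rw [Finset.sum_range_succ, add_mul, ih]
    push_cast
    have e1 : (2*((N:ℝ)+1)-1)*t = N*(2*t) + t := by ring
    have e2 : (2*(N:ℝ)-1)*t = N*(2*t) - t := by ring
    rw [e1, e2, Real.sin_add, Real.sin_sub]; ring

theorem sum_ksin_aux (t : ℝ) (N : ℕ) :
    (∑ k ∈ Finset.range N, (k:ℝ) * Real.sin (k * (2*t))) * (4 * Real.sin t ^ 2) =
      Real.sin (N * (2*t)) - 2 * N * Real.cos ((2*N-1) * t) * Real.sin t := by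
  induction N with
  | zero => simp
  | succ N ih =>
    rw [Finset.sum_range_succ, add_mul, ih]
    push_cast
    have e0 : ((N:ℝ)+1)*(2*t) = N*(2*t) + 2*t := by ring
    have e1 : (2*((N:ℝ)+1)-1)*t = N*(2*t) + t := by ring
    have e2 : (2*(N:ℝ)-1)*t = N*(2*t) - t := by ring
    rw [e0, e1, e2, Real.cos_add, Real.cos_sub, Real.sin_add, Real.sin_two_mul, Real.cos_two_mul']
    linear_combination (-Real.sin (N*(2*t))) * (Real.sin_sq_add_cos_sq t)

theorem sin_pi_ne {w : ℕ} (hw : 0 < w) {m : ℤ} (h : ¬ (w:ℤ) ∣ m) :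
    Real.sin (Real.pi * ((m:ℝ)/w)) ≠ 0 := by
  intro h0
  rw [Real.sin_eq_zero_iff] at h0
  obtain ⟨j, hj⟩ := h0
  apply h
  refine ⟨j, ?_⟩
  have hw' : (w:ℝ) ≠ 0 := by positivity
  have : (m:ℝ)/w = j := by
    have := Real.pi_ne_zero
    field_simp at hj ⊢
    linarith
  rw [div_eq_iff hw'] at this
  have h3 : m = j * w := by exact_mod_cast this
  rw [h3]; ring

theorem sum_saw_sin {w : ℕ} (hw : 0 < w) (m : ℤ) :
    ∑ k ∈ Finset.range w, saw ((k:ℝ)/w) * Real.sin (2 * Real.pi * k * m / w) =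
      -(1/2) * ct ((m:ℝ)/w) := by
  have hw' : (w:ℝ) ≠ 0 := by positivity
  by_cases h : (w:ℤ) ∣ m
  · obtain ⟨j, rfl⟩ := h
    have e : (((w:ℤ)*j : ℤ):ℝ)/w = (j:ℤ) := by push_cast; field_simp
    rw [e, ct_int, mul_zero]
    apply Finset.sum_eq_zero
    intro k _
    have : 2 * Real.pi * k * (((w:ℤ)*j:ℤ):ℝ) / w = ((2*k*j : ℤ):ℝ) * Real.pi := by
      push_cast; field_simp
    rw [this, Real.sin_int_mul_pi, mul_zero]
  · have hs := sin_pi_ne hw h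
    set t := Real.pi * ((m:ℝ)/w) with ht
    have h1 : ∑ k ∈ Finset.range w, saw ((k:ℝ)/w) * Real.sin (2 * Real.pi * k * m / w) =
        (1/w) * (∑ k ∈ Finset.range w, (k:ℝ) * Real.sin (k * (2*t)))
          - 1/2 * (∑ k ∈ Finset.range w, Real.sin (k * (2*t))) := by
      rw [Finset.mul_sum, Finset.mul_sum, ← Finset.sum_sub_distrib]
      apply Finset.sum_congr rfl
      intro k hk
      have e : 2 * Real.pi * k * m / w = k * (2*t) := by rw [ht]; ring
      rw [e]
      rcases Nat.eq_zero_or_pos k with rfl | hk0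
      · simp
      · rw [saw_lt hk0 (Finset.mem_range.1 hk)]; ring
    have e1 : (2*(w:ℝ)-1)*t = (m:ℝ) * (2*Real.pi) - t := by rw [ht]; field_simp
    have e2 : (w:ℝ)*(2*t) = ((2*m:ℤ):ℝ) * Real.pi := by rw [ht]; push_cast; field_simp
    have hc : Real.cos ((2*(w:ℝ)-1)*t) = Real.cos t := by
      rw [e1, Real.cos_int_mul_two_pi_sub]
    have A := sum_sin_aux t w
    have B := sum_ksin_aux t w
    rw [hc] at A B
    rw [e2, Real.sin_int_mul_pi] at B
    rw [h1]
    have A' : (∑ k ∈ Finset.range w, Real.sin (k * (2*t))) = 0 := by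
      have : (∑ k ∈ Finset.range w, Real.sin (k * (2*t))) * (2 * Real.sin t) = 0 := by
        rw [A]; ring
      rcases mul_eq_zero.1 this with h | h
      · exact h
      · exact absurd (by linarith) hs
    rw [A']
    have B' : (∑ k ∈ Finset.range w, (k:ℝ) * Real.sin (k * (2*t))) =
        - (w * Real.cos t / (2 * Real.sin t)) := by
      have h4 : (4 * Real.sin t ^ 2) ≠ 0 := by positivity
      rw [eq_comm, ← mul_right_cancel_iff_of_pos (show (0:ℝ) < 4 * Real.sin t ^ 2 by positivity), B]
      field_simp
      ring
    rw [B']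
    unfold ct
    rw [← ht]
    field_simp
    ring

theorem sum_cos_orth {w : ℕ} (hw : 0 < w) (j : ℤ) :
    ∑ m ∈ Finset.range w, Real.cos (2 * Real.pi * m * j / w) = if (w:ℤ) ∣ j then (w:ℝ) else 0 := by
  have hw' : (w:ℝ) ≠ 0 := by positivity
  split_ifs with h
  · obtain ⟨i, rfl⟩ := h
    rw [Finset.sum_congr rfl (g := fun _ => (1:ℝ))]
    · simp
    · intro k _
      have : 2 * Real.pi * k * (((w:ℤ)*i:ℤ):ℝ) / w = ((k*i : ℤ):ℝ) * (2*Real.pi) := by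
        push_cast; field_simp
      rw [this, Real.cos_int_mul_two_pi]
  · have hs := sin_pi_ne hw h
    set t := Real.pi * ((j:ℝ)/w) with ht
    have e1 : (2*(w:ℝ)-1)*t = (j:ℝ) * (2*Real.pi) - t := by rw [ht]; field_simp
    have A := sum_cos_aux t w
    rw [e1, Real.sin_int_mul_two_pi_sub] at A
    have : ∑ m ∈ Finset.range w, Real.cos (2 * Real.pi * m * j / w) =
      ∑ k ∈ Finset.range w, Real.cos (k * (2*t)) := by
      apply Finset.sum_congr rfl
      intro k _
      congr 1; rw [ht]; ring
    rw [this]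
    have : (∑ k ∈ Finset.range w, Real.cos (k * (2*t))) * (2 * Real.sin t) = 0 := by
        rw [A]; ring
    rcases mul_eq_zero.1 this with h | h
    · exact h
    · exact absurd (by linarith) hs

theorem saw_fourier_lt {w : ℕ} (hw : 0 < w) (n : ℕ) (hn : n < w) :
    ∑ m ∈ Finset.range w, ct ((m:ℝ)/w) * Real.sin (2 * Real.pi * m * n / w) =
      -(2 * w) * saw ((n:ℝ)/w) := by
  have hw' : (w:ℝ) ≠ 0 := by positivity
  have h1 : ∀ m ∈ Finset.range w, ct ((m:ℝ)/w) * Real.sin (2 * Real.pi * m * n / w) =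
      ∑ k ∈ Finset.range w, (-saw ((k:ℝ)/w)) *
        (Real.cos (2 * Real.pi * m * ((k - n : ℤ):ℝ) / w) -
          Real.cos (2 * Real.pi * m * ((k + n : ℤ):ℝ) / w)) := by
    intro m _
    have := sum_saw_sin hw (m:ℤ)
    have h2 : ct ((m:ℝ)/w) =
        ∑ k ∈ Finset.range w, (-2) * (saw ((k:ℝ)/w) * Real.sin (2 * Real.pi * k * m / w)) := by
      rw [← Finset.mul_sum]
      push_cast at this
      rw [this]; ring
    rw [h2, Finset.sum_mul]
    apply Finset.sum_congr rfl
    intro k _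
    have e1 : 2 * Real.pi * m * ((k - n : ℤ):ℝ) / w =
      2 * Real.pi * k * m / w - 2 * Real.pi * m * n / w := by push_cast; ring
    have e2 : 2 * Real.pi * m * ((k + n : ℤ):ℝ) / w =
      2 * Real.pi * k * m / w + 2 * Real.pi * m * n / w := by push_cast; ring
    rw [e1, e2, Real.cos_sub, Real.cos_add]; ring
  rw [Finset.sum_congr rfl h1, Finset.sum_comm]
  simp_rw [← Finset.mul_sum, Finset.sum_sub_distrib, sum_cos_orth hw]
  simp_rw [mul_sub, Finset.sum_sub_distrib]
  have hA : ∑ k ∈ Finset.range w, (-saw ((k:ℝ)/w)) * (if (w:ℤ) ∣ (k - n : ℤ) then (w:ℝ) else 0) =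
      - w * saw ((n:ℝ)/w) := by
    rw [Finset.sum_eq_single n]
    · simp; ring
    · intro k hk hkn
      rw [if_neg, mul_zero]
      intro hd
      have := Finset.mem_range.1 hk
      have h3 := Int.eq_zero_of_abs_lt_dvd hd (by rw [abs_lt]; constructor <;> omega)
      omega
    · intro h; exact absurd (Finset.mem_range.2 hn) h
  have hB : ∑ k ∈ Finset.range w, (-saw ((k:ℝ)/w)) * (if (w:ℤ) ∣ (k + n : ℤ) then (w:ℝ) else 0) =
      w * saw ((n:ℝ)/w) := by
    rcases Nat.eq_zero_or_pos n with rfl | hn0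
    · rw [Finset.sum_eq_zero]
      · simp [saw_zero]
      · intro k hk
        rcases Nat.eq_zero_or_pos k with rfl | hk0
        · simp [saw_zero]
        · rw [if_neg, mul_zero]
          intro hd
          have := Finset.mem_range.1 hk
          have h3 := Int.eq_zero_of_abs_lt_dvd hd (by rw [abs_lt]; constructor <;> omega)
          omega
    · rw [Finset.sum_eq_single (w - n)]
      · rw [if_pos]
        · have : (((w - n : ℕ)):ℝ)/w = -((n:ℝ)/w) + (1:ℤ) := by
            rw [Nat.cast_sub hn.le]; push_cast; field_simp; ring
          rw [this, saw_add_int, saw_neg]; ring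
        · rw [Nat.cast_sub hn.le]; simp
      · intro k hk hkn
        rw [if_neg, mul_zero]
        intro hd
        have := Finset.mem_range.1 hk
        have hd' : (w:ℤ) ∣ (k + n - w : ℤ) := Dvd.dvd.sub hd (dvd_refl _)
        have h3 := Int.eq_zero_of_abs_lt_dvd hd' (by rw [abs_lt]; constructor <;> omega)
        omega
      · intro h; exact absurd (Finset.mem_range.2 (by omega)) h
  rw [hA, hB]; ring

theorem saw_fourier {w : ℕ} (hw : 0 < w) (n : ℕ) :
    ∑ m ∈ Finset.range w, ct ((m:ℝ)/w) * Real.sin (2 * Real.pi * m * n / w) =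
      -(2 * w) * saw ((n:ℝ)/w) := by
  have hw' : (w:ℝ) ≠ 0 := by positivity
  have h := saw_fourier_lt hw (n % w) (Nat.mod_lt _ hw)
  have hn : (n:ℝ) = (n % w : ℕ) + w * (n / w : ℕ) := by exact_mod_cast (Nat.mod_add_div n w).symm
  have e1 : (n:ℝ)/w = ((n % w : ℕ):ℝ)/w + ((n/w : ℕ):ℤ) := by
    rw [Int.cast_natCast, hn.trans (add_comm _ _), add_div, mul_div_cancel_left₀ _ hw', add_comm]
  rw [e1, saw_add_int, ← h]
  apply Finset.sum_congr rfl
  intro m _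
  have : 2 * Real.pi * m * n / w = 2 * Real.pi * m * (n % w : ℕ) / w +
      ((m * (n/w:ℕ) : ℕ):ℝ) * (2 * Real.pi) := by
    conv_lhs => rw [hn]
    push_cast; field_simp
  rw [this, Real.sin_add_nat_mul_two_pi]

theorem dedekind_cot {w : ℕ} (hw : 0 < w) (v : ℕ) :
    dedekindSum v w = 1/(4*w) * ∑ m ∈ Finset.range w, ct ((m:ℝ)/w) * ct ((m:ℝ)*v/w) := by
  have hw' : (w:ℝ) ≠ 0 := by positivity
  have h0 : dedekindSum v w = ∑ n ∈ Finset.range w, saw ((n : ℝ) / w) * saw ((n : ℝ) * v / w) := by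
    unfold dedekindSum
    simp only [Int.toNat_natCast, Int.cast_natCast]
    obtain ⟨u, rfl⟩ : ∃ u, w = u + 1 := ⟨w - 1, by omega⟩
    rw [Finset.sum_range_succ', ← Finset.Ico_succ_right_eq_Icc, Finset.sum_Ico_eq_sum_range]
    simp only [Nat.succ_eq_succ, Nat.succ_eq_add_one, Nat.add_sub_cancel]
    rw [Finset.sum_range_succ]
    have e : saw (((1 + u : ℕ):ℝ) / ((u + 1 : ℕ):ℝ)) = 0 := by
      rw [add_comm 1 u, div_self hw']
      have := saw_add_int 0 1
      rw [saw_zero] at this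
      simpa using this
    rw [e]
    simp only [Nat.cast_zero, zero_div, saw_zero, zero_mul, add_zero]
    apply Finset.sum_congr rfl
    intro k _
    rw [add_comm 1 k]
  rw [h0]
  have h1 : ∀ n ∈ Finset.range w, saw ((n : ℝ) / w) * saw ((n : ℝ) * v / w) =
      ∑ m ∈ Finset.range w, (-(1/(2*w)) * ct ((m:ℝ)/w)) *
        (saw ((n:ℝ)/w) * Real.sin (2 * Real.pi * n * ((m * v : ℕ):ℤ) / w)) := by
    intro n _
    have h2 := saw_fourier hw (n * v)
    have h3 : saw ((n : ℝ) * v / w) = -(1/(2*w)) * ∑ m ∈ Finset.range w, ct ((m:ℝ)/w) *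
        Real.sin (2 * Real.pi * m * (n * v : ℕ) / w) := by
      rw [h2]; push_cast; field_simp
    rw [h3, Finset.mul_sum, Finset.mul_sum]
    apply Finset.sum_congr rfl
    intro m _
    have : 2 * Real.pi * m * (n * v : ℕ) / w = 2 * Real.pi * n * ((m * v : ℕ):ℤ) / w := by
      push_cast; ring
    rw [this]; ring
  rw [Finset.sum_congr rfl h1, Finset.sum_comm, Finset.mul_sum]
  apply Finset.sum_congr rfl
  intro m _
  rw [← Finset.mul_sum, sum_saw_sin hw]
  push_cast
  field_simp
  ring


theorem residue_sum {w : ℕ} (n : ℕ) (hw : 0 < w) (φ : ℕ → ℝ)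
    (hφ : ∀ i j, 1 ≤ i → i ≤ j → φ j ≤ φ i) (h0 : ∀ i, 0 ≤ φ i) :
    ∑ v ∈ (Finset.range w).filter (fun v => n * v % w ≠ 0), φ (n * v % w) ≤
      ∑ j ∈ Finset.Ico 1 w, φ j := by
  set g := Nat.gcd w n with hg
  have hgpos : 0 < g := Nat.gcd_pos_of_pos_left _ hw
  set w' := w / g with hw'
  have hww : w = w' * g := (Nat.div_mul_cancel (Nat.gcd_dvd_left w n)).symm
  have hw'pos : 0 < w' := by
    rcases Nat.eq_zero_or_pos w' with h | h
    · rw [h] at hww; omega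
    · exact h
  have key : ∀ v ∈ (Finset.range w).filter (fun v => n * v % w ≠ 0),
      v / w' < g ∧ g ≤ n * v % w ∧ g ∣ n * v % w ∧ n * v % w < w := by
    intro v hv
    rw [Finset.mem_filter, Finset.mem_range] at hv
    have hd : g ∣ n * v % w :=
      (Nat.dvd_mod_iff (Nat.gcd_dvd_left w n)).2 (Dvd.dvd.mul_right (Nat.gcd_dvd_right w n) v)
    refine ⟨?_, Nat.le_of_dvd (Nat.pos_of_ne_zero hv.2) hd, hd, Nat.mod_lt _ hw⟩
    rw [Nat.div_lt_iff_lt_mul hw'pos, mul_comm, ← hww]; exact hv.1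
  calc _ ≤ ∑ v ∈ (Finset.range w).filter (fun v => n * v % w ≠ 0), φ (n * v % w - v / w') := by
        apply Finset.sum_le_sum
        intro v hv
        obtain ⟨h1, h2, -, -⟩ := key v hv
        clear_value w'
        generalize v / w' = r at *
        exact hφ _ _ (by omega) (Nat.sub_le _ _)
    _ = ∑ j ∈ ((Finset.range w).filter (fun v => n * v % w ≠ 0)).image
          (fun v => n * v % w - v / w'), φ j := by
        rw [Finset.sum_image]
        intro v hv u hu h
        obtain ⟨h1, h2, h3, -⟩ := key v hv
        obtain ⟨k1, k2, k3, -⟩ := key u hu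
        simp only at h
        have e : n * v % w + u / w' = n * u % w + v / w' := by omega
        have e1 : v / w' = u / w' := by
          have := congrArg (· % g) e
          simp only [Nat.add_mod, Nat.mod_eq_zero_of_dvd h3, Nat.mod_eq_zero_of_dvd k3, zero_add,
            Nat.mod_mod, Nat.mod_eq_of_lt h1, Nat.mod_eq_of_lt k1] at this
          exact this.symm
        have e2 : n * v ≡ n * u [MOD w] := by unfold Nat.ModEq; omega
        have e3 : v ≡ u [MOD w'] := Nat.ModEq.cancel_left_div_gcd hw e2
        unfold Nat.ModEq at e3
        rw [← Nat.mod_add_div v w', ← Nat.mod_add_div u w', e1, e3]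
    _ ≤ _ := by
        apply Finset.sum_le_sum_of_subset_of_nonneg
        · intro j hj
          rw [Finset.mem_image] at hj
          obtain ⟨v, hv, rfl⟩ := hj
          obtain ⟨h1, h2, -, h4⟩ := key v hv
          clear_value w'
          generalize v / w' = r at *
          rw [Finset.mem_Ico]
          exact ⟨by omega, lt_of_le_of_lt (Nat.sub_le _ _) h4⟩
        · intro i _ _; exact h0 i

theorem mul_pred_mod {w : ℕ} (x : ℕ) (hw : 0 < w) (h : x % w ≠ 0) :
    (w - 1) * x % w = w - x % w := by
  have hlt := Nat.mod_lt x hw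
  have h1 : ((w - 1) * x + x) % w = 0 := by
    have : (w - 1) * x + x = w * x := by
      obtain ⟨u, rfl⟩ : ∃ u, w = u + 1 := ⟨w - 1, by omega⟩
      simp; ring
    rw [this]; simp
  have hlt2 := Nat.mod_lt ((w-1)*x) hw
  rw [Nat.add_mod] at h1
  have := Nat.div_add_mod ((w - 1) * x % w + x % w) w
  rw [h1] at this
  have h3 : w * (((w - 1) * x % w + x % w) / w) < w * 2 := by omega
  have h4 := Nat.lt_of_mul_lt_mul_left h3
  have h5 : ((w - 1) * x % w + x % w) / w = 1 := by
    rcases Nat.eq_zero_or_pos (((w - 1) * x % w + x % w) / w) with h | h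
    · rw [h] at this; omega
    · omega
  rw [h5] at this; omega

theorem residue_sum2 {w : ℕ} (n : ℕ) (hw : 0 < w) (φ : ℕ → ℝ)
    (hφ : ∀ i j, 1 ≤ i → i ≤ j → φ j ≤ φ i) (h0 : ∀ i, 0 ≤ φ i) (f : ℕ → ℝ)
    (hf0 : ∀ v, n * v % w = 0 → f v = 0)
    (hf : ∀ v, n * v % w ≠ 0 → f v ≤ φ (n * v % w) + φ (w - n * v % w)) :
    ∑ v ∈ Finset.range w, f v ≤ 2 * ∑ j ∈ Finset.Ico 1 w, φ j := by
  have e : ∑ v ∈ Finset.range w, f v =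
      ∑ v ∈ (Finset.range w).filter (fun v => n * v % w ≠ 0), f v := by
    rw [Finset.sum_filter]
    apply Finset.sum_congr rfl
    intro v _
    split_ifs with h
    · rfl
    · exact hf0 v (not_not.1 h)
  rw [e, two_mul]
  have h1 := residue_sum n hw φ hφ h0
  have h2 := residue_sum ((w-1)*n) hw φ hφ h0
  have e2 : (Finset.range w).filter (fun v => (w-1)*n * v % w ≠ 0) =
      (Finset.range w).filter (fun v => n * v % w ≠ 0) := by
    apply Finset.filter_congr
    intro v _
    rw [mul_assoc]
    constructor
    · intro h h'
      apply h
      rw [Nat.mul_mod, h']; simp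
    · intro h
      rw [mul_pred_mod _ hw h]
      have := Nat.mod_lt (n * v) hw
      omega
  rw [e2] at h2
  have h3 : ∑ v ∈ (Finset.range w).filter (fun v => n * v % w ≠ 0), φ ((w-1)*n * v % w) =
      ∑ v ∈ (Finset.range w).filter (fun v => n * v % w ≠ 0), φ (w - n * v % w) := by
    apply Finset.sum_congr rfl
    intro v hv
    rw [mul_assoc, mul_pred_mod _ hw (Finset.mem_filter.1 hv).2]
  rw [h3] at h2
  calc _ ≤ ∑ v ∈ (Finset.range w).filter (fun v => n * v % w ≠ 0),
        (φ (n * v % w) + φ (w - n * v % w)) :=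
        Finset.sum_le_sum (fun v hv => hf v (Finset.mem_filter.1 hv).2)
    _ ≤ _ := by rw [Finset.sum_add_distrib]; exact add_le_add h1 h2

theorem hsum_le (N : ℕ) : ∑ j ∈ Finset.Icc 1 N, (1:ℝ)/j ≤ 1 + Real.log N := by
  have := harmonic_le_one_add_log N
  rw [harmonic_eq_sum_Icc] at this
  push_cast at this
  simpa using this

theorem le_hsum (N : ℕ) : Real.log ((N:ℝ)+1) ≤ ∑ j ∈ Finset.Icc 1 N, (1:ℝ)/j := by
  have := log_add_one_le_harmonic N
  rw [harmonic_eq_sum_Icc] at this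
  push_cast at this
  simpa using this

/-- `1 / |sin (π x)|`, zero at integers -/
noncomputable def iS (x : ℝ) : ℝ := 1 / |Real.sin (Real.pi * x)|

theorem iS_nonneg (x : ℝ) : 0 ≤ iS x := by unfold iS; positivity

theorem iS_add_int (x : ℝ) (m : ℤ) : iS (x + m) = iS x := by
  unfold iS
  rw [mul_add, mul_comm Real.pi (m:ℝ), Real.sin_add_int_mul_pi, abs_mul]
  rcases Int.even_or_odd m with h | h
  · rw [h.neg_one_zpow]; simp
  · rw [h.neg_one_zpow]; simp

theorem iS_int (m : ℤ) : iS m = 0 := by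
  unfold iS
  rw [mul_comm, Real.sin_int_mul_pi]; simp

theorem abs_ct_le (x : ℝ) : |ct x| ≤ iS x := by
  unfold ct iS
  rw [abs_div]
  exact div_le_div_of_nonneg_right (Real.abs_cos_le_one _) (abs_nonneg _)

theorem iS_le_half {r w : ℕ} (hr : 0 < r) (h : 2 * r ≤ w) : iS ((r:ℝ)/w) ≤ w / (2 * r) := by
  unfold iS
  have hr' : (0:ℝ) < r := by exact_mod_cast hr
  have hw' : (0:ℝ) < w := by exact_mod_cast (by omega : 0 < w)
  have h' : 2 * (r:ℝ) ≤ w := by exact_mod_cast h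
  have h1 : 2 / Real.pi * (Real.pi * ((r:ℝ)/w)) ≤ Real.sin (Real.pi * ((r:ℝ)/w)) := by
    apply Real.mul_le_sin
    · positivity
    · have : (r:ℝ)/w ≤ 1/2 := by rw [div_le_div_iff₀ hw' (by norm_num)]; linarith
      nlinarith [Real.pi_pos]
  have h2 : 2 / Real.pi * (Real.pi * ((r:ℝ)/w)) = 2 * r / w := by
    field_simp
  rw [h2] at h1
  have h3 : 0 < 2 * (r:ℝ)/w := by positivity
  rw [abs_of_pos (lt_of_lt_of_le h3 h1)]
  calc _ ≤ 1 / (2 * (r:ℝ)/w) := one_div_le_one_div_of_le h3 h1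
    _ = _ := by rw [one_div_div]

theorem mod_div_eq (x w : ℕ) (hw : 0 < w) : (x:ℝ)/w = ((x % w : ℕ):ℝ)/w + ((x / w : ℕ):ℤ) := by
  have hw' : (w:ℝ) ≠ 0 := by positivity
  have hn : (x:ℝ) = (x % w : ℕ) + w * (x / w : ℕ) := by exact_mod_cast (Nat.mod_add_div x w).symm
  rw [Int.cast_natCast, hn.trans (add_comm _ _), add_div, mul_div_cancel_left₀ _ hw', add_comm]

theorem psi_res {w : ℕ} (hw : 0 < w) (ψ : ℝ → ℝ) (hψ : ∀ x y, 0 ≤ x → x ≤ y → ψ x ≤ ψ y)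
    (h0 : ψ 0 = 0) (n : ℕ) :
    ∑ v ∈ Finset.range w, ψ (iS ((n:ℝ)*v/w)) ≤ 2 * ∑ j ∈ Finset.Ico 1 w, ψ ((w:ℝ)/(2*j)) := by
  have hnn : ∀ x, 0 ≤ x → 0 ≤ ψ x := fun x hx => by rw [← h0]; exact hψ _ _ le_rfl hx
  apply residue_sum2 n hw (fun j => ψ ((w:ℝ)/(2*j)))
  · intro i j hi hij
    apply hψ _ _ (by positivity)
    have hi' : (0:ℝ) < i := by exact_mod_cast hi
    have hij' : (i:ℝ) ≤ j := by exact_mod_cast hij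
    gcongr
  · intro i; exact hnn _ (by positivity)
  · intro v hv
    have : (n:ℝ)*v/w = ((n * v / w : ℕ) : ℤ) := by
      have := mod_div_eq (n*v) w hw
      rw [hv] at this
      push_cast at this ⊢
      rw [this]; simp
    rw [this, iS_int, h0]
  · intro v hv
    have hlt := Nat.mod_lt (n * v) hw
    set r := n * v % w with hr
    have e : iS ((n:ℝ)*v/w) = iS ((r:ℝ)/w) := by
      have := mod_div_eq (n*v) w hw
      rw [Nat.cast_mul] at this
      rw [this, iS_add_int]
    rw [e]
    by_cases h : 2 * r ≤ w
    · have := hψ _ _ (iS_nonneg _) (iS_le_half (Nat.pos_of_ne_zero hv) h)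
      have h2 := hnn ((w:ℝ)/(2*(w - r : ℕ))) (by positivity)
      linarith
    · have e2 : iS ((r:ℝ)/w) = iS (((w - r : ℕ):ℝ)/w) := by
        have hw' : (w:ℝ) ≠ 0 := by positivity
        have : ((w - r : ℕ):ℝ)/w = -((r:ℝ)/w) + (1:ℤ) := by
          rw [Nat.cast_sub hlt.le]; field_simp; push_cast; ring
        rw [this, iS_add_int]
        unfold iS; rw [mul_neg, Real.sin_neg, abs_neg]
      rw [e2]
      have := hψ _ _ (iS_nonneg _) (iS_le_half (r := w - r) (w := w) (by omega) (by omega))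
      have h2 := hnn ((w:ℝ)/(2*(r : ℕ))) (by positivity)
      linarith

theorem sum_iS {w : ℕ} (hw : 0 < w) (n : ℕ) :
    ∑ v ∈ Finset.range w, iS ((n:ℝ)*v/w) ≤ w * (1 + Real.log w) := by
  have h := psi_res hw (fun x => x) (fun x y _ h => h) rfl n
  refine h.trans ?_
  have e : 2 * ∑ j ∈ Finset.Ico 1 w, (w:ℝ)/(2*j) = w * ∑ j ∈ Finset.Ico 1 w, (1:ℝ)/j := by
    rw [Finset.mul_sum, Finset.mul_sum]
    apply Finset.sum_congr rfl
    intro j hj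
    have : (0:ℝ) < j := by exact_mod_cast (Finset.mem_Ico.1 hj).1
    field_simp
  rw [e]
  apply mul_le_mul_of_nonneg_left _ (by positivity)
  refine le_trans ?_ (hsum_le w)
  apply Finset.sum_le_sum_of_subset_of_nonneg Finset.Ico_subset_Icc_self
  intros; positivity

theorem sum_min_iS {w M T : ℕ} (hw : 0 < w) (hM : 0 < M) (hT : 0 < T) (hMT : w ≤ M * T) (n : ℕ) :
    ∑ v ∈ Finset.range w, min (iS ((n:ℝ)*v/w)) (iS ((n:ℝ)*v/w)^2/(2*M)) ≤
      w * (2 + Real.log T) := by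
  have hM' : (0:ℝ) < M := by exact_mod_cast hM
  have hT' : (0:ℝ) < T := by exact_mod_cast hT
  have hw' : (0:ℝ) < w := by exact_mod_cast hw
  have hMT' : (w:ℝ) ≤ M * T := by exact_mod_cast hMT
  have h := psi_res hw (fun x => min x (x^2/(2*M)))
    (fun x y hx h => by
      apply min_le_min h
      gcongr) (by simp) n
  refine h.trans ?_
  have h1 : ∑ j ∈ Finset.Ico 1 w, min ((w:ℝ)/(2*j)) (((w:ℝ)/(2*j))^2/(2*M)) ≤
      ∑ j ∈ Finset.Icc 1 T, (w:ℝ)/(2*j) + ∑ j ∈ Finset.Ioc T (T + w), ((w:ℝ)/(2*j))^2/(2*M) := by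
    calc _ ≤ ∑ j ∈ Finset.Icc 1 T ∪ Finset.Ioc T (T+w),
          min ((w:ℝ)/(2*j)) (((w:ℝ)/(2*j))^2/(2*M)) := by
          apply Finset.sum_le_sum_of_subset_of_nonneg
          · intro j hj
            simp only [Finset.mem_Ico, Finset.mem_union, Finset.mem_Icc, Finset.mem_Ioc] at hj ⊢
            omega
          · intros; positivity
      _ = ∑ j ∈ Finset.Icc 1 T, min ((w:ℝ)/(2*j)) (((w:ℝ)/(2*j))^2/(2*M)) +
          ∑ j ∈ Finset.Ioc T (T+w), min ((w:ℝ)/(2*j)) (((w:ℝ)/(2*j))^2/(2*M)) := by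
          rw [Finset.sum_union]
          rw [Finset.disjoint_left]
          intro j hj hj'
          simp only [Finset.mem_Icc, Finset.mem_Ioc] at hj hj'
          omega
      _ ≤ _ := by
          apply add_le_add
          · exact Finset.sum_le_sum (fun j _ => min_le_left _ _)
          · exact Finset.sum_le_sum (fun j _ => min_le_right _ _)
  have h2 : ∑ j ∈ Finset.Icc 1 T, (w:ℝ)/(2*j) ≤ w/2 * (1 + Real.log T) := by
    have : ∑ j ∈ Finset.Icc 1 T, (w:ℝ)/(2*j) = w/2 * ∑ j ∈ Finset.Icc 1 T, (1:ℝ)/j := by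
      rw [Finset.mul_sum]
      apply Finset.sum_congr rfl
      intro j _; ring
    rw [this]
    exact mul_le_mul_of_nonneg_left (hsum_le T) (by positivity)
  have h3 : ∑ j ∈ Finset.Ioc T (T + w), ((w:ℝ)/(2*j))^2/(2*M) ≤ (w:ℝ)/8 := by
    have : ∑ j ∈ Finset.Ioc T (T+w), ((w:ℝ)/(2*j))^2/(2*M) =
        w^2/(8*M) * ∑ j ∈ Finset.Ioc T (T+w), ((j:ℝ)^2)⁻¹ := by
      rw [Finset.mul_sum]
      apply Finset.sum_congr rfl
      intro j _; ring
    rw [this]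
    have h4 := sum_Ioc_inv_sq_le_sub (α := ℝ) hT.ne' (show T ≤ T + w by omega)
    have h5 : ∑ j ∈ Finset.Ioc T (T+w), ((j:ℝ)^2)⁻¹ ≤ (T:ℝ)⁻¹ :=
      h4.trans (by have : (0:ℝ) ≤ ((T+w:ℕ):ℝ)⁻¹ := by positivity
                   linarith)
    calc _ ≤ (w:ℝ)^2/(8*M) * (T:ℝ)⁻¹ := mul_le_mul_of_nonneg_left h5 (by positivity)
      _ ≤ w/8 := by
        rw [← div_eq_mul_inv, div_div, div_le_div_iff₀ (by positivity) (by norm_num)]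
        nlinarith
  nlinarith


theorem ct_nonneg {x : ℝ} (hx : 0 < x) (h : x ≤ 1/2) : 0 ≤ ct x := by
  unfold ct
  have := Real.pi_pos
  apply div_nonneg
  · exact Real.cos_nonneg_of_neg_pi_div_two_le_of_le (by nlinarith) (by nlinarith)
  · exact Real.sin_nonneg_of_nonneg_of_le_pi (by nlinarith) (by nlinarith)

theorem ct_anti {x y : ℝ} (hx : 0 < x) (hxy : x ≤ y) (h : y ≤ 1/2) : ct y ≤ ct x := by
  unfold ct
  have := Real.pi_pos
  apply div_le_div₀
  · exact Real.cos_nonneg_of_neg_pi_div_two_le_of_le (by nlinarith) (by nlinarith)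
  · exact Real.cos_le_cos_of_nonneg_of_le_pi (by positivity) (by nlinarith) (by nlinarith)
  · exact Real.sin_pos_of_pos_of_lt_pi (by positivity) (by nlinarith)
  · exact Real.sin_le_sin_of_le_of_le_pi_div_two (by nlinarith) (by nlinarith) (by nlinarith)

theorem ct_le {x : ℝ} (hx : 0 < x) (h : x ≤ 1/2) : ct x ≤ 1 / (Real.pi * x) := by
  have := Real.pi_pos
  have h1 : 0 < Real.pi * x := by positivity
  have hs : 0 < Real.sin (Real.pi * x) := Real.sin_pos_of_pos_of_lt_pi h1 (by nlinarith)
  unfold ct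
  rw [div_le_div_iff₀ hs h1]
  rcases eq_or_lt_of_le h with h | h
  · subst h
    have : Real.pi * (1/2) = Real.pi/2 := by ring
    rw [this, Real.cos_pi_div_two, Real.sin_pi_div_two]; norm_num
  · have h2 := Real.le_tan h1.le (by nlinarith)
    rw [Real.tan_eq_sin_div_cos, le_div_iff₀
      (Real.cos_pos_of_mem_Ioo ⟨by nlinarith, by nlinarith⟩)] at h2
    linarith

theorem le_ct {x : ℝ} (hx : 0 < x) (h : x ≤ 1/2) :
    1 / (Real.pi * x) - Real.pi * x / 2 ≤ ct x := by
  have := Real.pi_pos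
  have h1 : 0 < Real.pi * x := by positivity
  have hs : 0 < Real.sin (Real.pi * x) := Real.sin_pos_of_pos_of_lt_pi h1 (by nlinarith)
  unfold ct
  have hc : 0 ≤ Real.cos (Real.pi * x) :=
    Real.cos_nonneg_of_neg_pi_div_two_le_of_le (by nlinarith) (by nlinarith)
  calc _ = (1 - (Real.pi * x)^2/2) / (Real.pi * x) := by field_simp
    _ ≤ Real.cos (Real.pi * x) / (Real.pi * x) := by
      gcongr; exact Real.one_sub_sq_div_two_le_cos
    _ ≤ _ := by
      apply div_le_div_of_nonneg_left hc hs (Real.sin_le h1.le)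

theorem abel_bound (ω a : ℕ → ℝ) (N : ℕ) (B : ℝ)
    (hB : ∀ k ≤ N, |∑ i ∈ Finset.range k, a i| ≤ B)
    (hω : ∀ i j, i ≤ j → j < N → ω j ≤ ω i) (h0 : ∀ i, i < N → 0 ≤ ω i) (h00 : 0 ≤ ω 0) :
    |∑ i ∈ Finset.range N, ω i * a i| ≤ ω 0 * B := by
  have hB0 : 0 ≤ B := by simpa using hB 0 (Nat.zero_le _)
  rcases Nat.eq_zero_or_pos N with h | hN
  · subst h; simp; positivity
  have key : ∀ k, k + 1 ≤ N → |∑ i ∈ Finset.range (k+1), ω i * a i -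
      ω k * ∑ i ∈ Finset.range (k+1), a i| ≤ (ω 0 - ω k) * B := by
    intro k
    induction k with
    | zero => intro _; simp
    | succ k ih =>
      intro hk
      have h1 := ih (by omega)
      have e : ∑ i ∈ Finset.range (k+1+1), ω i * a i - ω (k+1) * ∑ i ∈ Finset.range (k+1+1), a i
         = (∑ i ∈ Finset.range (k+1), ω i * a i - ω k * ∑ i ∈ Finset.range (k+1), a i) +
          (ω k - ω (k+1)) * ∑ i ∈ Finset.range (k+1), a i := by
        rw [Finset.sum_range_succ _ (k+1), Finset.sum_range_succ _ (k+1)]; ring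
      rw [e]
      have h2 : 0 ≤ ω k - ω (k+1) := by linarith [hω k (k+1) (by omega) (by omega)]
      have h3 := hB (k+1) (by omega)
      calc _ ≤ _ := abs_add_le _ _
        _ ≤ (ω 0 - ω k) * B + (ω k - ω (k+1)) * B := by
          rw [abs_mul (ω k - ω (k+1)), abs_of_nonneg h2]
          gcongr
        _ = _ := by ring
  obtain ⟨k, rfl⟩ : ∃ k, N = k + 1 := ⟨N - 1, by omega⟩
  have h1 := key k le_rfl
  have h2 := hB (k+1) le_rfl
  have h3 := h0 k (by omega)
  calc _ = |(∑ i ∈ Finset.range (k+1), ω i * a i - ω k * ∑ i ∈ Finset.range (k+1), a i) +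
        ω k * ∑ i ∈ Finset.range (k+1), a i| := by ring_nf
    _ ≤ _ := abs_add_le _ _
    _ ≤ (ω 0 - ω k) * B + ω k * B := by
      rw [abs_mul (ω k), abs_of_nonneg h3]; gcongr
    _ = _ := by ring

theorem sum_cos_odd (t : ℝ) (M : ℕ) :
    (∑ m ∈ Finset.range M, Real.cos ((2*m+1)*t)) * (2 * Real.sin t) = Real.sin (2*M*t) := by
  induction M with
  | zero => simp
  | succ M ih =>
    rw [Finset.sum_range_succ, add_mul, ih]
    have e1 : (2*(M:ℝ)*t) = (2*M+1)*t - t := by ring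
    have e2 : (2*((M+1:ℕ):ℝ)*t) = (2*M+1)*t + t := by push_cast; ring
    rw [e1, e2, Real.sin_sub, Real.sin_add]; ring

theorem ct_fejer (x : ℝ) {M : ℕ} (hM : 0 < M) :
    |ct x - (1/M) * ∑ m ∈ Finset.range M, ∑ l ∈ Finset.range (m+1),
      2 * Real.sin (l * (2 * (Real.pi * x)))| ≤ min (iS x) (iS x ^ 2 / (2*M)) := by
  have hM' : (0:ℝ) < M := by exact_mod_cast hM
  by_cases hs : Real.sin (Real.pi * x) = 0
  · have h1 : ct x = 0 := by unfold ct; rw [hs]; simp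
    have h2 : iS x = 0 := by unfold iS; rw [hs]; simp
    have h3 : ∀ l : ℕ, Real.sin (l * (2 * (Real.pi * x))) = 0 := by
      intro l
      obtain ⟨k, hk⟩ := Real.sin_eq_zero_iff.1 hs
      rw [← hk]
      have : (l:ℝ) * (2 * (k * Real.pi)) = ((l * (2 * k) : ℤ):ℝ) * Real.pi := by push_cast; ring
      rw [this, Real.sin_int_mul_pi]
    rw [h1, h2]; simp [h3]
  have e : ct x - (1/M) * ∑ m ∈ Finset.range M, ∑ l ∈ Finset.range (m+1),
      2 * Real.sin (l * (2 * (Real.pi * x))) =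
      (1/M) * ∑ m ∈ Finset.range M, Real.cos ((2*m+1)*(Real.pi*x)) / Real.sin (Real.pi * x) := by
    have : ∀ m ∈ Finset.range M, ∑ l ∈ Finset.range (m+1), 2 * Real.sin (l * (2 * (Real.pi * x)))
       = ct x - Real.cos ((2*m+1)*(Real.pi*x)) / Real.sin (Real.pi * x) := by
      intro m _
      have h := sum_sin_aux (Real.pi * x) (m+1)
      rw [← Finset.mul_sum]
      have e3 : (2 * ((m+1:ℕ):ℝ) - 1) = 2*m+1 := by push_cast; ring
      rw [e3] at h
      unfold ct
      rw [← sub_div, eq_div_iff hs]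
      linarith
    rw [Finset.sum_congr rfl this, Finset.sum_sub_distrib]
    simp only [Finset.sum_const, Finset.card_range, nsmul_eq_mul]
    rw [mul_sub, ← mul_assoc, one_div_mul_cancel hM'.ne']
    ring
  rw [e, abs_mul, abs_of_pos (by positivity : (0:ℝ) < 1/M)]
  apply le_min
  · calc _ ≤ (1/(M:ℝ)) * ∑ m ∈ Finset.range M, iS x := by
          gcongr
          refine (Finset.abs_sum_le_sum_abs _ _).trans (Finset.sum_le_sum ?_)
          intro m _
          rw [abs_div]
          exact div_le_div_of_nonneg_right (Real.abs_cos_le_one _) (abs_nonneg _)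
      _ = _ := by simp; field_simp
  · rw [← Finset.sum_div]
    have h := sum_cos_odd (Real.pi * x) M
    have h2 : ∑ m ∈ Finset.range M, Real.cos ((2*m+1)*(Real.pi*x)) =
       Real.sin (2*M*(Real.pi*x)) / (2 * Real.sin (Real.pi * x)) := by
      rw [eq_div_iff (by simpa using hs), h]
    rw [h2, div_div, abs_div]
    have h3 : |2 * Real.sin (Real.pi * x) * Real.sin (Real.pi * x)| =
      2 * |Real.sin (Real.pi * x)|^2 := by
      rw [abs_mul, abs_mul, abs_two]; ring
    rw [h3]
    have h4 : 0 < |Real.sin (Real.pi * x)| := abs_pos.2 hs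
    calc _ ≤ (1/(M:ℝ)) * (1 / (2 * |Real.sin (Real.pi * x)|^2)) := by
          gcongr; exact Real.abs_sin_le_one _
      _ = _ := by unfold iS; field_simp

theorem sin_part (x : ℝ) (a k : ℕ) :
    |∑ i ∈ Finset.range k, Real.sin ((a + i : ℕ) * (2 * (Real.pi * x)))| ≤ iS x := by
  by_cases hs : Real.sin (Real.pi * x) = 0
  · have h2 : iS x = 0 := by unfold iS; rw [hs]; simp
    have h3 : ∀ l : ℕ, Real.sin (l * (2 * (Real.pi * x))) = 0 := by
      intro l
      obtain ⟨k, hk⟩ := Real.sin_eq_zero_iff.1 hs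
      rw [← hk]
      have : (l:ℝ) * (2 * (k * Real.pi)) = ((l * (2 * k) : ℤ):ℝ) * Real.pi := by push_cast; ring
      rw [this, Real.sin_int_mul_pi]
    rw [h2]; simp only [h3]; simp
  have h1 := sum_sin_aux (Real.pi * x) a
  have h2 := sum_sin_aux (Real.pi * x) (a + k)
  rw [Finset.sum_range_add, add_mul, h1] at h2
  have h4 : 0 < |Real.sin (Real.pi * x)| := abs_pos.2 hs
  set S := ∑ i ∈ Finset.range k, Real.sin ((a + i : ℕ) * (2 * (Real.pi * x))) with hS
  have h5 : |S| * (2 * |Real.sin (Real.pi * x)|) ≤ 2 := by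
    have : |S| * (2 * |Real.sin (Real.pi * x)|) = |S * (2 * Real.sin (Real.pi * x))| := by
      rw [abs_mul, abs_mul]; simp
    rw [this]
    have : S * (2 * Real.sin (Real.pi * x)) = Real.cos ((2 * a - 1) * (Real.pi * x)) -
      Real.cos ((2 * (a + k : ℕ) - 1) * (Real.pi * x)) := by linarith
    rw [this, abs_le]
    constructor <;> linarith [Real.cos_le_one ((2 * a - 1) * (Real.pi * x)),
      Real.neg_one_le_cos ((2 * a - 1) * (Real.pi * x)),
      Real.cos_le_one ((2 * (a + k : ℕ) - 1) * (Real.pi * x)),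
      Real.neg_one_le_cos ((2 * (a + k : ℕ) - 1) * (Real.pi * x))]
  unfold iS
  rw [le_div_iff₀ h4]; linarith

theorem omega_sin {w a b : ℕ} (hw : 0 < w) (ha : 0 < a) (hb : 2 * b ≤ w + 2) (h2 : 2 * a ≤ w)
    (x : ℝ) :
    |∑ n ∈ Finset.Ico a b, ct ((n:ℝ)/w) * Real.sin (n * (2 * (Real.pi * x)))| ≤
      ct ((a:ℝ)/w) * iS x := by
  have hw' : (0:ℝ) < w := by exact_mod_cast hw
  have hpos : ∀ i : ℕ, 0 < ((a + i : ℕ):ℝ)/w := by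
    intro i
    have : (0:ℝ) < (a + i : ℕ) := by exact_mod_cast (by omega)
    positivity
  have hle : ∀ i : ℕ, 2 * (a + i) ≤ w → ((a + i : ℕ):ℝ)/w ≤ 1/2 := by
    intro i hi
    rw [div_le_div_iff₀ hw' (by norm_num)]
    have : (2:ℝ) * (a + i : ℕ) ≤ w := by exact_mod_cast hi
    linarith
  rw [Finset.sum_Ico_eq_sum_range]
  apply abel_bound (fun i => ct (((a + i : ℕ):ℝ)/w))
    (fun i => Real.sin ((a + i : ℕ) * (2 * (Real.pi * x))))
  · intro k _; exact sin_part x a k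
  · intro i j hij hj
    apply ct_anti (hpos i) _ (hle j (by omega))
    gcongr
  · intro i hi
    exact ct_nonneg (hpos i) (hle i (by omega))
  · exact ct_nonneg (hpos 0) (hle 0 (by omega))

theorem large_n {w a b M T : ℕ} (hw : 0 < w) (ha : 0 < a) (hb : 2 * b ≤ w + 2)
    (hM : 0 < M) (hT : 0 < T) (hMT : w ≤ M * T) :
    ∑ v ∈ Finset.range w, |∑ n ∈ Finset.Ico a b, ct ((n:ℝ)/w) * ct ((n:ℝ)*v/w)| ≤
      (w * (w * (2 + Real.log T)) + 2 * M * (w * (1 + Real.log w))) * (w / a) := by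
  have hw' : (0:ℝ) < w := by exact_mod_cast hw
  have ha' : (0:ℝ) < a := by exact_mod_cast ha
  have hM' : (0:ℝ) < M := by exact_mod_cast hM
  have hlw : 0 ≤ Real.log w := Real.log_natCast_nonneg w
  have hlT : 0 ≤ Real.log T := Real.log_natCast_nonneg T
  by_cases hab : b ≤ a
  · rw [Finset.Ico_eq_empty_of_le hab]; simp; positivity
  have h2 : 2 * a ≤ w := by omega
  have h2' : (2:ℝ) * a ≤ w := by exact_mod_cast h2
  have hca : ct ((a:ℝ)/w) ≤ w / a := by
    refine (ct_le (by positivity) (by rw [div_le_div_iff₀ hw' (by norm_num)]; linarith)).trans ?_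
    rw [div_le_div_iff₀ (by positivity) ha']
    have : Real.pi * ((a:ℝ)/w) * w = Real.pi * a := by field_simp
    nlinarith [Real.pi_gt_three]
  have hn1 : ∀ n ∈ Finset.Ico a b, 0 ≤ ct ((n:ℝ)/w) ∧ ct ((n:ℝ)/w) ≤ w / a := by
    intro n hn
    rw [Finset.mem_Ico] at hn
    have h3 : (a:ℝ) ≤ n := by exact_mod_cast hn.1
    have h4 : (2:ℝ) * n ≤ w := by exact_mod_cast (by omega)
    have h5 : (n:ℝ)/w ≤ 1/2 := by rw [div_le_div_iff₀ hw' (by norm_num)]; linarith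
    refine ⟨ct_nonneg (div_pos (by linarith) hw') h5, le_trans (ct_anti (by positivity) ?_ h5) hca⟩
    gcongr
  have pt : ∀ v ∈ Finset.range w, |∑ n ∈ Finset.Ico a b, ct ((n:ℝ)/w) * ct ((n:ℝ)*v/w)| ≤
      ∑ n ∈ Finset.Ico a b, (w/a) * min (iS ((n:ℝ)*v/w)) (iS ((n:ℝ)*v/w)^2/(2*M)) +
      (1/M) * ∑ m ∈ Finset.range M, ∑ l ∈ Finset.range (m+1), 2 * ((w/a) * iS ((l:ℝ)*v/w)) := by
    intro v _
    have e : ∑ n ∈ Finset.Ico a b, ct ((n:ℝ)/w) * ct ((n:ℝ)*v/w) =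
      ∑ n ∈ Finset.Ico a b, ct ((n:ℝ)/w) * (ct ((n:ℝ)*v/w) -
        (1/M) * ∑ m ∈ Finset.range M, ∑ l ∈ Finset.range (m+1),
          2 * Real.sin (l * (2 * (Real.pi * ((n:ℝ)*v/w))))) +
      (1/M) * ∑ m ∈ Finset.range M, ∑ l ∈ Finset.range (m+1),
        2 * ∑ n ∈ Finset.Ico a b, ct ((n:ℝ)/w) * Real.sin (n * (2 * (Real.pi * ((l:ℝ)*v/w)))) := by
      have : (1/(M:ℝ)) * ∑ m ∈ Finset.range M, ∑ l ∈ Finset.range (m+1),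
        2 * ∑ n ∈ Finset.Ico a b, ct ((n:ℝ)/w) * Real.sin (n * (2 * (Real.pi * ((l:ℝ)*v/w)))) =
        ∑ n ∈ Finset.Ico a b, ct ((n:ℝ)/w) * ((1/M) * ∑ m ∈ Finset.range M,
          ∑ l ∈ Finset.range (m+1), 2 * Real.sin (l * (2 * (Real.pi * ((n:ℝ)*v/w))))) := by
        simp only [Finset.mul_sum]
        rw [Finset.sum_comm (s := Finset.Ico a b)]
        apply Finset.sum_congr rfl
        intro m _
        rw [Finset.sum_comm (s := Finset.Ico a b)]
        apply Finset.sum_congr rfl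
        intro l _
        apply Finset.sum_congr rfl
        intro n _
        have : (n:ℝ) * (2 * (Real.pi * ((l:ℝ)*v/w))) = l * (2 * (Real.pi * ((n:ℝ)*v/w))) := by ring
        rw [this]; ring
      rw [this, ← Finset.sum_add_distrib]
      apply Finset.sum_congr rfl
      intro n _; ring
    rw [e]
    refine (abs_add_le _ _).trans (add_le_add ?_ ?_)
    · refine (Finset.abs_sum_le_sum_abs _ _).trans (Finset.sum_le_sum ?_)
      intro n hn
      rw [abs_mul, abs_of_nonneg (hn1 n hn).1]
      exact mul_le_mul (hn1 n hn).2 (ct_fejer _ hM) (abs_nonneg _) (by positivity)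
    · rw [abs_mul, abs_of_pos (by positivity : (0:ℝ) < 1/M)]
      gcongr
      refine (Finset.abs_sum_le_sum_abs _ _).trans (Finset.sum_le_sum ?_)
      intro m _
      refine (Finset.abs_sum_le_sum_abs _ _).trans (Finset.sum_le_sum ?_)
      intro l _
      rw [abs_mul]
      simp only [abs_two]
      gcongr
      refine (omega_sin hw ha hb h2 _).trans ?_
      exact mul_le_mul_of_nonneg_right hca (iS_nonneg _)
  refine (Finset.sum_le_sum pt).trans ?_
  rw [Finset.sum_add_distrib, add_mul]
  apply add_le_add
  · rw [Finset.sum_comm]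
    calc _ ≤ ∑ n ∈ Finset.Ico a b, (w/a) * (w * (2 + Real.log T)) := by
          apply Finset.sum_le_sum
          intro n _
          rw [← Finset.mul_sum]
          exact mul_le_mul_of_nonneg_left (sum_min_iS hw hM hT hMT n) (by positivity)
      _ = ((b - a : ℕ):ℝ) * ((w/a) * (w * (2 + Real.log T))) := by simp
      _ ≤ w * ((w/a) * (w * (2 + Real.log T))) := by
          gcongr; omega
      _ = _ := by ring
  · rw [← Finset.mul_sum]
    rw [Finset.sum_comm]
    have h3 : ∀ m ∈ Finset.range M, ∑ v ∈ Finset.range w, ∑ l ∈ Finset.range (m+1),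
        2 * ((w/a) * iS ((l:ℝ)*v/w)) ≤ M * (2 * ((w/a) * (w * (1 + Real.log w)))) := by
      intro m hm
      rw [Finset.mem_range] at hm
      rw [Finset.sum_comm]
      calc _ ≤ ∑ l ∈ Finset.range (m+1), (2 * ((w/a) * (w * (1 + Real.log w)))) := by
            apply Finset.sum_le_sum
            intro l _
            rw [← Finset.mul_sum, ← Finset.mul_sum]
            gcongr
            exact sum_iS hw l
        _ = ((m+1:ℕ):ℝ) * (2 * ((w/a) * (w * (1 + Real.log w)))) := by
            rw [Finset.sum_const, Finset.card_range, nsmul_eq_mul]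
        _ ≤ _ := by gcongr; omega
    calc _ ≤ (1/(M:ℝ)) * ∑ m ∈ Finset.range M, M * (2 * ((w/a) * (w * (1 + Real.log w)))) := by
          gcongr with m hm
          exact h3 m hm
      _ = _ := by
          rw [Finset.sum_const, Finset.card_range, nsmul_eq_mul]; field_simp


theorem ct_half : ct (1/2) = 0 := by
  unfold ct
  have : Real.pi * (1/2) = Real.pi/2 := by ring
  rw [this, Real.cos_pi_div_two]; simp

theorem dedekind_half {w : ℕ} (hw : 0 < w) (v : ℕ) :
    dedekindSum v w = 1/(2*w) * ∑ n ∈ Finset.Ico 1 (w/2+1), ct ((n:ℝ)/w) * ct ((n:ℝ)*v/w) := by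
  rw [dedekind_cot hw v]
  have hw' : (0:ℝ) < w := by exact_mod_cast hw
  set f : ℕ → ℝ := fun n => ct ((n:ℝ)/w) * ct ((n:ℝ)*v/w) with hf
  have f0 : f 0 = 0 := by
    have := ct_int 0
    simp only [hf]; simp at this ⊢; exact this
  have frefl : ∀ n, n ≤ w → f (w - n) = f n := by
    intro n hn
    simp only [hf]
    have e1 : ((w - n : ℕ):ℝ)/w = -((n:ℝ)/w) + (1:ℤ) := by
      rw [Nat.cast_sub hn]; field_simp; push_cast; ring
    have e2 : ((w - n : ℕ):ℝ)*v/w = -((n:ℝ)*v/w) + (v:ℤ) := by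
      rw [Nat.cast_sub hn]; field_simp; push_cast; ring
    rw [e1, e2, ct_add_int, ct_add_int, ct_neg, ct_neg]; ring
  have fhalf : ∀ n, 2 * n = w → f n = 0 := by
    intro n hn
    simp only [hf]
    have : (n:ℝ)/w = 1/2 := by
      rw [← hn] at hw' ⊢
      push_cast at hw' ⊢
      have : (n:ℝ) ≠ 0 := by intro h; rw [h] at hw'; simp at hw'
      field_simp
    rw [this, ct_half]; simp
  have e : ∑ m ∈ Finset.range w, f m = 2 * ∑ n ∈ Finset.Ico 1 (w/2+1), f n := by
    rcases Nat.lt_or_ge w 2 with h | h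
    · have : w = 1 := by omega
      subst this; simp [f0]
    rw [Finset.range_eq_Ico, ← Finset.sum_Ico_consecutive f (Nat.zero_le 1) (by omega : 1 ≤ w),
      ← Finset.sum_Ico_consecutive f (by omega : 1 ≤ w/2+1) (by omega : w/2+1 ≤ w)]
    have e1 : ∑ n ∈ Finset.Ico (w/2+1) w, f n = ∑ n ∈ Finset.Ico 1 (w - w/2), f n := by
      apply Finset.sum_nbij' (fun n => w - n) (fun n => w - n)
      · intro n hn; rw [Finset.mem_Ico] at hn ⊢; omega
      · intro n hn; rw [Finset.mem_Ico] at hn ⊢; omega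
      · intro n hn; rw [Finset.mem_Ico] at hn; omega
      · intro n hn; rw [Finset.mem_Ico] at hn; omega
      · intro n hn; rw [Finset.mem_Ico] at hn; exact (frefl n (by omega)).symm
    have e2 : ∑ n ∈ Finset.Ico 1 (w - w/2), f n = ∑ n ∈ Finset.Ico 1 (w/2+1), f n := by
      rcases Nat.even_or_odd w with ⟨u, hu⟩ | ⟨u, hu⟩
      · have h1 : w / 2 = u := by omega
        have h2 : w - w/2 = u := by omega
        rw [h1, hu] 
        rw [show u + u - u = u by omega, Finset.sum_Ico_succ_top (by omega), fhalf u (by omega)]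
        simp
      · have : w - w/2 = w/2+1 := by omega
        rw [this]
    rw [e1, e2]; simp [f0]; ring
  rw [e]
  field_simp
  ring

noncomputable def Eb (L T : ℕ) (w : ℝ) : ℝ :=
  w * (1 + Real.log w) / L^2 + L * (w * (2 + Real.log T) + 2 * (w/T + 1) * (1 + Real.log w))

theorem partD_w {w L T : ℕ} (hw : 0 < w) (hL : 2 ≤ L) (hT : 0 < T) :
    ∑ v ∈ Finset.range w, |dedekindSum v w -
      ∑ n ∈ Finset.Ico 1 (w/L+1), 1/(2*Real.pi*n) * ct ((n:ℝ)*v/w)| ≤ Eb L T w := by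
  have hw' : (0:ℝ) < w := by exact_mod_cast hw
  have hL' : (2:ℝ) ≤ L := by exact_mod_cast hL
  have hT' : (0:ℝ) < T := by exact_mod_cast hT
  have hpi := Real.pi_gt_three
  have hlw : 0 ≤ Real.log w := Real.log_natCast_nonneg w
  have hlT : 0 ≤ Real.log T := Real.log_natCast_nonneg T
  have hLw : w/L ≤ w/2 := Nat.div_le_div_left hL (by norm_num)
  set a := w/L+1 with ha
  have ha1 : 1 ≤ a := Nat.le_add_left _ _
  have hM1 : 0 < w/T+1 := Nat.succ_pos _
  have haL : (w:ℝ) / a ≤ L := by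
    rw [div_le_iff₀ (by rw [ha]; positivity)]
    have : w < L * (w/L+1) := Nat.lt_mul_div_succ w (by omega)
    exact_mod_cast this.le
  have coef : ∀ n ∈ Finset.Ico 1 a, |1/(2*w) * ct ((n:ℝ)/w) - 1/(2*Real.pi*n)| ≤ 1/(L*w) := by
    intro n hn
    rw [Finset.mem_Ico] at hn
    have hn0 : (0:ℝ) < n := by exact_mod_cast hn.1
    have h1 : n ≤ w/L := by omega
    have h2 : n * L ≤ w := (Nat.le_div_iff_mul_le (by omega)).1 h1
    have h2' : (n:ℝ) * L ≤ w := by exact_mod_cast h2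
    have h3 : (n:ℝ)/w ≤ 1/2 := by
      rw [div_le_div_iff₀ hw' (by norm_num)]; nlinarith
    have h4 := ct_le (div_pos hn0 hw') h3
    have h5 := le_ct (div_pos hn0 hw') h3
    have e : 1/(2*w) * ct ((n:ℝ)/w) - 1/(2*Real.pi*n) =
      -(1/(2*w) * (1 / (Real.pi * ((n:ℝ)/w)) - ct ((n:ℝ)/w))) := by field_simp; ring
    rw [e, abs_neg, abs_of_nonneg (mul_nonneg (by positivity) (by linarith))]
    calc _ ≤ 1/(2*(w:ℝ)) * (Real.pi * ((n:ℝ)/w) / 2) := by gcongr; linarith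
      _ ≤ 1/(2*(w:ℝ)) * (2/L) := by
        apply mul_le_mul_of_nonneg_left _ (by positivity)
        have : (n:ℝ)/w ≤ 1/L := by
          rw [div_le_div_iff₀ hw' (by linarith)]; linarith
        have h7 := Real.pi_le_four
        calc Real.pi * ((n:ℝ)/w) / 2 ≤ 4 * (1/L) / 2 := by gcongr
          _ = _ := by ring
      _ = _ := by field_simp
  have pt : ∀ v ∈ Finset.range w, |dedekindSum v w -
      ∑ n ∈ Finset.Ico 1 a, 1/(2*Real.pi*n) * ct ((n:ℝ)*v/w)| ≤
      ∑ n ∈ Finset.Ico 1 a, 1/(L*w) * iS ((n:ℝ)*v/w) +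
      1/(2*w) * |∑ n ∈ Finset.Ico a (w/2+1), ct ((n:ℝ)/w) * ct ((n:ℝ)*v/w)| := by
    intro v _
    rw [dedekind_half hw v, ← Finset.sum_Ico_consecutive _ ha1 (by omega : a ≤ w/2+1)]
    have e : ∀ A B C : ℝ, 1/(2*w) * (A + B) - C = (1/(2*w) * A - C) + 1/(2*w)*B := by intros; ring
    rw [e]
    refine (abs_add_le _ _).trans (add_le_add ?_ ?_)
    · rw [Finset.mul_sum, ← Finset.sum_sub_distrib]
      refine (Finset.abs_sum_le_sum_abs _ _).trans (Finset.sum_le_sum ?_)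
      intro n hn
      rw [← mul_assoc, ← sub_mul, abs_mul]
      exact mul_le_mul (coef n hn) (abs_ct_le _) (abs_nonneg _) (by positivity)
    · rw [abs_mul, abs_of_pos (by positivity : (0:ℝ) < 1/(2*w))]
  refine (Finset.sum_le_sum pt).trans ?_
  rw [Finset.sum_add_distrib]
  unfold Eb
  apply add_le_add
  · rw [Finset.sum_comm]
    calc _ ≤ ∑ n ∈ Finset.Ico 1 a, 1/(L*w) * (w * (1 + Real.log w)) := by
          apply Finset.sum_le_sum
          intro n _
          rw [← Finset.mul_sum]
          exact mul_le_mul_of_nonneg_left (sum_iS hw n) (by positivity)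
      _ = ((w/L:ℕ):ℝ) * (1/(L*w) * (w * (1 + Real.log w))) := by simp [ha]
      _ ≤ ((w:ℝ)/L) * (1/(L*w) * (w * (1 + Real.log w))) := by
          gcongr; exact Nat.cast_div_le
      _ = _ := by field_simp
  · rw [← Finset.mul_sum]
    have hMT : w ≤ (w/T+1) * T := by
      have : w < T * (w/T+1) := Nat.lt_mul_div_succ w (by omega)
      rw [mul_comm]; exact this.le
    have h := large_n (b := w/2+1) hw ha1 (by omega) hM1 hT hMT
    have hM : ((w/T+1:ℕ):ℝ) ≤ (w:ℝ)/T + 1 := by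
      push_cast
      gcongr; exact Nat.cast_div_le
    calc _ ≤ 1/(2*(w:ℝ)) * ((w * (w * (2 + Real.log T)) + 2 * (w/T+1:ℕ) * (w * (1 + Real.log w))) * (w / a)) := by
          gcongr
      _ ≤ 1/(2*(w:ℝ)) * ((w * (w * (2 + Real.log T)) + 2 * ((w:ℝ)/T+1) * (w * (1 + Real.log w))) * L) := by
          gcongr
      _ = 1/2 * (L * (w * (2 + Real.log T) + 2 * ((w:ℝ)/T+1) * (1 + Real.log w))) := by
          field_simp
      _ ≤ _ := by
          have : 0 ≤ L * (w * (2 + Real.log T) + 2 * ((w:ℝ)/T+1) * (1 + Real.log w)) := by positivity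
          linarith

open Classical in
noncomputable def vset (α : ℝ) (w : ℕ) : Finset ℕ := (Finset.range w).filter (fun v : ℕ => (v:ℝ) < α * w)

noncomputable def Hs (α : ℝ) (Q : ℕ) : ℝ := ∑ w ∈ Finset.Icc 1 Q, ∑ v ∈ vset α w, dedekindSum v w

noncomputable def Yn (α : ℝ) (L Q n : ℕ) : ℝ :=
  ∑ w ∈ Finset.Icc (L*n) Q, ∑ v ∈ vset α w, ct ((n:ℝ)*v/w)

theorem partD (α : ℝ) {L T : ℕ} (hL : 2 ≤ L) (hT : 0 < T) (Q : ℕ) :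
    |Hs α Q - ∑ n ∈ Finset.Icc 1 Q, 1/(2*Real.pi*n) * Yn α L Q n| ≤ Q * Eb L T Q := by
  have e : ∑ n ∈ Finset.Icc 1 Q, 1/(2*Real.pi*n) * Yn α L Q n =
      ∑ w ∈ Finset.Icc 1 Q, ∑ v ∈ vset α w, ∑ n ∈ Finset.Ico 1 (w/L+1),
        1/(2*Real.pi*n) * ct ((n:ℝ)*v/w) := by
    unfold Yn
    simp only [Finset.mul_sum]
    rw [Finset.sum_comm' (t' := Finset.Icc 1 Q) (s' := fun w => Finset.Ico 1 (w/L+1))]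
    · apply Finset.sum_congr rfl
      intro w _
      rw [Finset.sum_comm]
    · intro n w
      simp only [Finset.mem_Icc, Finset.mem_Ico]
      rw [Nat.lt_succ_iff, Nat.le_div_iff_mul_le (by omega)]
      constructor
      · rintro ⟨⟨h1, h2⟩, h3, h4⟩
        refine ⟨⟨h1, by linarith⟩, ?_, h4⟩
        nlinarith
      · rintro ⟨⟨h1, h2⟩, h3, h4⟩
        refine ⟨⟨h1, by nlinarith⟩, by linarith, h4⟩
  rw [e]
  unfold Hs
  rw [← Finset.sum_sub_distrib]
  refine (Finset.abs_sum_le_sum_abs _ _).trans ?_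
  calc _ ≤ ∑ w ∈ Finset.Icc 1 Q, Eb L T Q := by
        apply Finset.sum_le_sum
        intro w hw
        rw [Finset.mem_Icc] at hw
        rw [← Finset.sum_sub_distrib]
        refine (Finset.abs_sum_le_sum_abs _ _).trans ?_
        refine (Finset.sum_le_sum_of_subset_of_nonneg (Finset.filter_subset _ _) (fun _ _ _ => abs_nonneg _)).trans ?_
        refine (partD_w (by omega) hL hT).trans ?_
        unfold Eb
        have h1 : (w:ℝ) ≤ Q := by exact_mod_cast hw.2
        have h0 : (0:ℝ) < w := by exact_mod_cast hw.1
        have h2 : Real.log w ≤ Real.log Q := Real.log_le_log h0 h1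
        have hlw : 0 ≤ Real.log w := Real.log_natCast_nonneg w
        have hlT : 0 ≤ Real.log T := Real.log_natCast_nonneg T
        gcongr
    _ = _ := by simp


def bb (n p : ℕ) (k : ℤ) (w : ℕ) : ℝ := if (n:ℤ) ∣ p*w + k then 1 else 0

theorem bb_nonneg (n p : ℕ) (k : ℤ) (w : ℕ) : 0 ≤ bb n p k w := by
  unfold bb; split_ifs <;> norm_num

theorem bb_none {n p : ℕ} {k : ℤ} (h : ¬ ∃ w0 : ℤ, (n:ℤ) ∣ p*w0+k) (w : ℕ) : bb n p k w = 0 := by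
  unfold bb; rw [if_neg]; exact fun h' => h ⟨w, h'⟩

theorem bb_count {n p : ℕ} (hn : 0 < n) {k : ℤ} (h : ∃ w0 : ℤ, (n:ℤ) ∣ p*w0+k) (Q j : ℕ)
    (hj : j ≤ Q + 1) :
    ((j / (n / Nat.gcd n p) : ℕ):ℝ) ≤ ∑ i ∈ Finset.range j, bb n p k (Q - i) ∧
    ∑ i ∈ Finset.range j, bb n p k (Q - i) ≤ ((j / (n / Nat.gcd n p) : ℕ):ℝ) + 1 := by
  obtain ⟨w0, hw0⟩ := h
  set m := n / Nat.gcd n p with hm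
  have hg : 0 < Nat.gcd n p := Nat.gcd_pos_of_pos_left _ hn
  have hmpos : 0 < m := Nat.div_pos (Nat.le_of_dvd hn (Nat.gcd_dvd_left n p)) hg
  have hm' : (m:ℤ) ≠ 0 := by exact_mod_cast hmpos.ne'
  set v : ℕ := (((Q:ℤ) - w0) % m).toNat with hv
  have hv' : (v:ℤ) = ((Q:ℤ) - w0) % m := by
    rw [hv, Int.toNat_of_nonneg (Int.emod_nonneg _ hm')]
  have key : ∀ i ∈ Finset.range j, bb n p k (Q - i) = if i ≡ v [MOD m] then 1 else 0 := by
    intro i hi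
    rw [Finset.mem_range] at hi
    unfold bb
    congr 1
    apply propext
    have h1 : ((Q - i : ℕ):ℤ) = (Q:ℤ) - i := by rw [Nat.cast_sub (by omega)]
    rw [h1]
    have h2 : (n:ℤ) ∣ p * ((Q:ℤ) - i) + k ↔ (n:ℤ) ∣ p * ((Q:ℤ) - i - w0) := by
      have : (p:ℤ) * ((Q:ℤ) - i) + k = p * ((Q:ℤ) - i - w0) + (p * w0 + k) := by ring
      rw [this]
      exact (Int.dvd_add_left hw0)
    rw [h2]
    have h3 : (n:ℤ) ∣ p * ((Q:ℤ) - i - w0) ↔ (m:ℤ) ∣ (Q:ℤ) - i - w0 := by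
      rw [Int.natCast_dvd, Int.natAbs_mul, Int.natAbs_natCast, Int.natCast_dvd]
      constructor
      · intro h
        have hc : Nat.Coprime (n / Nat.gcd n p) (p / Nat.gcd n p) := Nat.coprime_div_gcd_div_gcd hg
        apply hc.dvd_of_dvd_mul_left
        rw [← Nat.mul_dvd_mul_iff_left hg, ← mul_assoc, Nat.mul_div_cancel' (Nat.gcd_dvd_left n p),
          Nat.mul_div_cancel' (Nat.gcd_dvd_right n p)]
        exact h
      · intro h
        calc n = m * Nat.gcd n p := (Nat.div_mul_cancel (Nat.gcd_dvd_left n p)).symm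
          _ ∣ _ := by rw [mul_comm]; exact Nat.mul_dvd_mul (Nat.gcd_dvd_right n p) h
    rw [h3]
    have h4 : i ≡ v [MOD m] ↔ (i:ℤ) ≡ (v:ℤ) [ZMOD m] := Int.natCast_modEq_iff.symm
    rw [h4, hv', Int.modEq_iff_dvd]
    have h5 : (m:ℤ) ∣ ((Q:ℤ) - w0) % m - ((Q:ℤ) - w0) := by
      rw [Int.emod_def]
      exact ⟨-(((Q:ℤ) - w0) / m), by ring⟩
    have h6 : ((Q:ℤ) - w0) % m - i = (((Q:ℤ) - w0) % m - ((Q:ℤ) - w0)) + (Q - i - w0) := by ring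
    rw [h6]
    exact (Int.dvd_add_right h5).symm
  rw [Finset.sum_congr rfl key, Finset.sum_boole, ← Nat.count_eq_card_filter_range,
    Nat.count_modEq_card _ hmpos]
  push_cast
  split_ifs <;> simp

theorem bb_diff {n p : ℕ} (hn : 0 < n) (k : ℤ) (Q j : ℕ) (hj : j ≤ Q + 1) :
    |∑ i ∈ Finset.range j, (bb n p k (Q - i) - bb n p (-k) (Q - i))| ≤ 1 := by
  have hiff : (∃ w0 : ℤ, (n:ℤ) ∣ p*w0+k) ↔ (∃ w0 : ℤ, (n:ℤ) ∣ p*w0+(-k)) := by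
    constructor
    · rintro ⟨w, h⟩
      refine ⟨-w, ?_⟩
      have : (p:ℤ) * -w + -k = -(p*w+k) := by ring
      rw [this]; exact (Int.dvd_neg).2 h
    · rintro ⟨w, h⟩
      refine ⟨-w, ?_⟩
      have : (p:ℤ) * -w + k = -(p*w+(-k)) := by ring
      rw [this]; exact (Int.dvd_neg).2 h
  by_cases h : ∃ w0 : ℤ, (n:ℤ) ∣ p*w0+k
  · have h1 := bb_count hn h Q j hj
    have h2 := bb_count hn (hiff.1 h) Q j hj
    rw [Finset.sum_sub_distrib, abs_le]
    constructor <;> linarith [h1.1, h1.2, h2.1, h2.2]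
  · have h' := fun h2 => h (hiff.2 h2)
    simp [bb_none h, bb_none h']

/-- `ct (k/w)` restricted to `2k<w` -/
noncomputable def cw (k w : ℕ) : ℝ := if 2 * k < w then ct ((k:ℝ)/w) else 0

theorem cw_nonneg {k : ℕ} (hk : 0 < k) (w : ℕ) : 0 ≤ cw k w := by
  unfold cw
  split_ifs with h
  · have hw : (0:ℝ) < w := by exact_mod_cast (by omega)
    have h' : (2:ℝ) * k < w := by exact_mod_cast h
    have hk' : (0:ℝ) < k := by exact_mod_cast hk
    exact ct_nonneg (by positivity) (by rw [div_le_div_iff₀ hw (by norm_num)]; linarith)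
  · rfl

theorem cw_mono {k : ℕ} (hk : 0 < k) {w w' : ℕ} (hw : w ≤ w') : cw k w ≤ cw k w' := by
  by_cases h : 2 * k < w
  · unfold cw
    rw [if_pos h, if_pos (by omega)]
    have hw0 : (0:ℝ) < w := by exact_mod_cast (by omega)
    have h' : (2:ℝ) * k < w := by exact_mod_cast h
    have hk' : (0:ℝ) < k := by exact_mod_cast hk
    have hww : (w:ℝ) ≤ w' := by exact_mod_cast hw
    have hw0' : (0:ℝ) < w' := by linarith
    apply ct_anti (by positivity)
    · gcongr
    · rw [div_le_div_iff₀ hw0 (by norm_num)]; linarith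
  · have : cw k w = 0 := by unfold cw; rw [if_neg h]
    rw [this]; exact cw_nonneg hk _

theorem cw_le {k : ℕ} (hk : 0 < k) (w : ℕ) : cw k w ≤ w / (Real.pi * k) := by
  unfold cw
  split_ifs with h
  · have hw : (0:ℝ) < w := by exact_mod_cast (by omega)
    have h' : (2:ℝ) * k < w := by exact_mod_cast h
    have hk' : (0:ℝ) < k := by exact_mod_cast hk
    refine (ct_le (by positivity) (by rw [div_le_div_iff₀ hw (by norm_num)]; linarith)).trans ?_
    apply le_of_eq; field_simp
  · positivity

theorem sum_Icc_reflect (f : ℕ → ℝ) (a Q : ℕ) (ha : a ≤ Q + 1) :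
    ∑ w ∈ Finset.Icc a Q, f w = ∑ i ∈ Finset.range (Q + 1 - a), f (Q - i) := by
  apply Finset.sum_nbij' (fun w => Q - w) (fun i => Q - i)
  · intro w hw; simp only [Finset.mem_Icc, Finset.mem_range] at hw ⊢; omega
  · intro w hw; simp only [Finset.mem_Icc, Finset.mem_range] at hw ⊢; omega
  · intro w hw; simp only [Finset.mem_Icc] at hw; omega
  · intro w hw; simp only [Finset.mem_range] at hw; omega
  · intro w hw; simp only [Finset.mem_Icc] at hw
    congr 1; omega

noncomputable def Zsym (n p a Q : ℕ) : ℝ :=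
  ∑ k ∈ Finset.Icc 1 Q, ∑ w ∈ Finset.Icc a Q, cw k w * (bb n p k w - bb n p (-k) w)

theorem Zsym_le {n : ℕ} (hn : 0 < n) (p a Q : ℕ) :
    |Zsym n p a Q| ≤ Q * (1 + Real.log Q) := by
  unfold Zsym
  refine (Finset.abs_sum_le_sum_abs _ _).trans ?_
  calc _ ≤ ∑ k ∈ Finset.Icc 1 Q, (Q:ℝ) * (1 / (k:ℝ)) := by
        apply Finset.sum_le_sum
        intro k hk
        rw [Finset.mem_Icc] at hk
        have hk' : (0:ℝ) < k := by exact_mod_cast hk.1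
        by_cases ha : Q + 1 < a
        · rw [Finset.Icc_eq_empty (by omega)]; simp; positivity
        rw [sum_Icc_reflect _ _ _ (by omega)]
        have h := abel_bound (fun i => cw k (Q - i)) (fun i => bb n p k (Q - i) - bb n p (-k) (Q - i))
          (Q+1-a) 1 (fun j hj => bb_diff hn k Q j (by omega))
          (fun i j hij _ => cw_mono (by omega) (by omega)) (fun i _ => cw_nonneg (by omega) _)
          (cw_nonneg (by omega) _)
        refine h.trans ?_
        have h2 := cw_le (k := k) (by omega) (Q - 0)
        simp only [Nat.sub_zero, mul_one] at h2 ⊢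
        refine h2.trans ?_
        rw [div_le_iff₀ (by positivity)]
        have : (Q:ℝ) * (1/k) * (Real.pi * k) = Q * Real.pi := by field_simp
        rw [this]
        nlinarith [Real.pi_gt_three, (Nat.cast_nonneg Q : (0:ℝ) ≤ Q)]
    _ = Q * ∑ k ∈ Finset.Icc 1 Q, (1 / (k:ℝ)) := by rw [Finset.mul_sum]
    _ ≤ _ := mul_le_mul_of_nonneg_left (hsum_le Q) (by positivity)

theorem sum_dvd_le {g : ℕ} (hg : 0 < g) (Q : ℕ) :
    ∑ k ∈ (Finset.Icc 1 Q).filter (fun k => g ∣ k), (1:ℝ)/k ≤ (1 + Real.log Q) / g := by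
  have hg' : (0:ℝ) < g := by exact_mod_cast hg
  calc _ ≤ ∑ k ∈ (Finset.Icc 1 Q).image (fun k => g * k), (1:ℝ)/k := by
        apply Finset.sum_le_sum_of_subset_of_nonneg
        · intro k hk
          rw [Finset.mem_filter, Finset.mem_Icc] at hk
          obtain ⟨⟨h1, h2⟩, c, rfl⟩ := hk
          rw [Finset.mem_image]
          refine ⟨c, ?_, rfl⟩
          rw [Finset.mem_Icc]
          constructor
          · rcases Nat.eq_zero_or_pos c with h | h
            · subst h; simp at h1
            · exact h
          · nlinarith
        · intros; positivity
    _ = ∑ k ∈ Finset.Icc 1 Q, (1:ℝ)/((g * k : ℕ):ℝ) := by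
        rw [Finset.sum_image]
        intro a _ b _ h
        exact Nat.eq_of_mul_eq_mul_left hg h
    _ = (∑ k ∈ Finset.Icc 1 Q, (1:ℝ)/k) / g := by
        rw [Finset.sum_div]
        apply Finset.sum_congr rfl
        intro k hk; push_cast; rw [div_div, mul_comm]
    _ ≤ _ := by gcongr; exact hsum_le Q

/-- absolute bound; `e` a sign -/
theorem Zabs_le {n : ℕ} (hn : 0 < n) (p a Q : ℕ) (e : ℤ) (he : e = 1 ∨ e = -1) :
    ∑ k ∈ Finset.Icc 1 Q, ∑ w ∈ Finset.Icc a Q, cw k w * bb n p (e * k) w ≤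
      Q * (1 + Real.log Q) * ((Q + 1) / n + 1) := by
  set g := Nat.gcd n p with hg
  have hgpos : 0 < g := Nat.gcd_pos_of_pos_left _ hn
  have hg' : (0:ℝ) < g := by exact_mod_cast hgpos
  have hn' : (0:ℝ) < n := by exact_mod_cast hn
  have hl : 0 ≤ Real.log Q := Real.log_natCast_nonneg Q
  have hk : ∀ k ∈ Finset.Icc 1 Q, ∑ w ∈ Finset.Icc a Q, cw k w * bb n p (e * k) w ≤
      if g ∣ k then (Q * ((Q+1) * g / n + 1)) * ((1:ℝ)/k) else 0 := by
    intro k hk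
    rw [Finset.mem_Icc] at hk
    have hk' : (0:ℝ) < k := by exact_mod_cast hk.1
    by_cases h : ∃ w0 : ℤ, (n:ℤ) ∣ p*w0+e*k
    · have hgk : g ∣ k := by
        obtain ⟨w0, h⟩ := h
        have h1 : (g:ℤ) ∣ n := by exact_mod_cast Nat.gcd_dvd_left n p
        have h2 : (g:ℤ) ∣ p := by exact_mod_cast Nat.gcd_dvd_right n p
        have h3 : (g:ℤ) ∣ e * k := (Int.dvd_add_right (Dvd.dvd.mul_right h2 w0)).1 (h1.trans h)
        rcases he with rfl | rfl
        · rw [one_mul] at h3; exact_mod_cast h3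
        · rw [neg_one_mul] at h3; exact_mod_cast (Int.dvd_neg.1 h3)
      rw [if_pos hgk]
      by_cases ha : Q + 1 < a
      · rw [Finset.Icc_eq_empty (by omega)]; simp; positivity
      have hc := (bb_count hn h Q (Q+1-a) (by omega)).2
      rw [← sum_Icc_reflect _ _ _ (by omega)] at hc
      calc _ ≤ ∑ w ∈ Finset.Icc a Q, ((Q:ℝ) * (1/k)) * bb n p (e * k) w := by
            apply Finset.sum_le_sum
            intro w hw
            rw [Finset.mem_Icc] at hw
            apply mul_le_mul_of_nonneg_right _ (bb_nonneg _ _ _ _)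
            refine (cw_le (by omega) w).trans ?_
            have : (w:ℝ) ≤ Q := by exact_mod_cast hw.2
            rw [div_le_iff₀ (by positivity)]
            have e2 : (Q:ℝ) * (1/k) * (Real.pi * k) = Q * Real.pi := by field_simp
            rw [e2]
            nlinarith [Real.pi_gt_three, (Nat.cast_nonneg Q : (0:ℝ) ≤ Q)]
        _ = ((Q:ℝ) * (1/k)) * ∑ w ∈ Finset.Icc a Q, bb n p (e * k) w := by rw [Finset.mul_sum]
        _ ≤ ((Q:ℝ) * (1/k)) * ((Q+1) * g / n + 1) := by
            apply mul_le_mul_of_nonneg_left _ (by positivity)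
            refine hc.trans ?_
            gcongr
            calc (((Q + 1 - a) / (n / Nat.gcd n p) : ℕ):ℝ) ≤ ((Q + 1 - a : ℕ):ℝ) / ((n / Nat.gcd n p : ℕ):ℝ) := Nat.cast_div_le
              _ = ((Q + 1 - a : ℕ):ℝ) / ((n:ℝ) / g) := by
                  rw [Nat.cast_div (Nat.gcd_dvd_left n p) (by exact_mod_cast hgpos.ne')]
              _ ≤ ((Q+1:ℕ):ℝ) / ((n:ℝ)/g) := by gcongr; omega
              _ = _ := by push_cast; field_simp
        _ = _ := by ring
    · simp only [bb_none h]
      split_ifs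
      · simp; positivity
      · simp
  refine (Finset.sum_le_sum hk).trans ?_
  rw [← Finset.sum_filter, ← Finset.mul_sum]
  have h1 : (1:ℝ) ≤ g := by exact_mod_cast hgpos
  calc _ ≤ (Q * ((Q+1) * g / n + 1)) * ((1 + Real.log Q) / g) := by
        gcongr; exact sum_dvd_le hgpos Q
    _ = Q * (1 + Real.log Q) * ((Q + 1) / n + 1/g) := by field_simp
    _ ≤ _ := by
        gcongr
        rw [div_le_one hg']; exact h1


noncomputable def Zp (α : ℝ) (n p a Q : ℕ) : ℝ :=
  ∑ w ∈ Finset.Icc a Q, ∑ v ∈ vset α w,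
    if 2 * |(n:ℤ) * v - p * w| < w then ct ((((n:ℤ) * v - p * w : ℤ):ℝ)/w) else 0

theorem ct_split {n v w : ℕ} (hv : v < w) :
    ct ((n:ℝ)*v/w) = ∑ p ∈ Finset.range (n+1),
      if 2 * |(n:ℤ) * v - p * w| < w then ct ((((n:ℤ) * v - p * w : ℤ):ℝ)/w) else 0 := by
  have hw : 0 < w := by omega
  have hw' : (w:ℝ) ≠ 0 := by positivity
  set q := (2 * (n * v) + w) / (2 * w) with hq
  have h1 : 2 * w * q ≤ 2 * (n * v) + w := Nat.mul_div_le _ _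
  have h2 : 2 * (n * v) + w < 2 * w * (q + 1) := Nat.lt_mul_div_succ _ (by omega)
  clear_value q
  have hqn : q ≤ n := by
    by_contra h
    push Not at h
    have h3 : 2 * w * (n + 1) ≤ 2 * w * q := Nat.mul_le_mul_left _ h
    have h4 : n * v ≤ n * w := Nat.mul_le_mul_left _ hv.le
    nlinarith
  have h1' : 2 * (w:ℤ) * q ≤ 2 * (n * v) + w := by exact_mod_cast h1
  have h2' : 2 * ((n:ℤ) * v) + w < 2 * w * (q + 1) := by exact_mod_cast h2
  have hwz : (0:ℤ) < w := by exact_mod_cast hw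
  rw [Finset.sum_eq_single q]
  · have e : (((n:ℤ) * v - q * w : ℤ):ℝ)/w = (n:ℝ)*v/w + ((-q : ℤ):ℝ) := by
      push_cast; field_simp; ring
    rw [e, ct_add_int]
    split_ifs with h
    · rfl
    · have h3 : 2 * ((n:ℤ) * v - q * w) = - w := by
        by_contra h4
        apply h
        have h5 : 2 * |(n:ℤ) * v - q * w| = |2 * ((n:ℤ) * v - q * w)| := by
          rw [abs_mul]; simp
        rw [h5, abs_lt]
        constructor
        · apply lt_of_le_of_ne _ (Ne.symm h4)
          nlinarith
        · nlinarith
      have h3' : 2 * ((n:ℝ) * v - q * w) = - w := by exact_mod_cast h3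
      have e2 : (n:ℝ)*v/w = -(1/2) + (q:ℤ) := by
        push_cast; field_simp; linarith
      rw [e2, ct_add_int, ct_neg, ct_half]; simp
  · intro p _ hp
    rw [if_neg]
    intro h
    have h5 : 2 * |(n:ℤ) * v - p * w| = |2 * ((n:ℤ) * v - p * w)| := by
      rw [abs_mul]; simp
    rw [h5, abs_lt] at h
    rcases Nat.lt_or_gt_of_ne hp with hp | hp
    · have : (p:ℤ) + 1 ≤ q := by exact_mod_cast hp
      nlinarith [h.1, h.2]
    · have : (q:ℤ) + 1 ≤ p := by exact_mod_cast hp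
      nlinarith [h.1, h.2]
  · intro h; exfalso; apply h; rw [Finset.mem_range]; omega

theorem Yn_eq (α : ℝ) (L Q n : ℕ) :
    Yn α L Q n = ∑ p ∈ Finset.range (n+1), Zp α n p (L*n) Q := by
  unfold Yn Zp
  rw [Finset.sum_comm]
  apply Finset.sum_congr rfl
  intro w _
  rw [Finset.sum_comm]
  apply Finset.sum_congr rfl
  intro v hv
  exact ct_split (Finset.mem_range.1 (Finset.mem_filter.1 hv).1)

noncomputable def cc (α : ℝ) (n p : ℕ) (k : ℤ) (w : ℕ) : ℝ :=
  ∑ v ∈ vset α w, if (n:ℤ) * v = p * w + k then 1 else 0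

theorem term_k (d : ℤ) {w Q : ℕ} (hw : w ≤ Q) :
    (if 2 * |d| < w then ct ((d:ℝ)/w) else 0) =
      ∑ k ∈ Finset.Icc 1 Q, cw k w * ((if d = k then 1 else 0) - (if d = -k then 1 else 0)) := by
  have hct0 : ct 0 = 0 := by simpa using ct_int 0
  rcases lt_trichotomy d 0 with h | h | h
  · obtain ⟨m, rfl⟩ : ∃ m : ℕ, d = -m := ⟨d.natAbs, by omega⟩
    have hm : 0 < m := by omega
    have e : ∑ k ∈ Finset.Icc 1 Q, cw k w * ((if (-(m:ℤ)) = k then (1:ℝ) else 0) -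
        (if (-(m:ℤ)) = -k then 1 else 0)) = ∑ k ∈ Finset.Icc 1 Q, if k = m then - cw m w else 0 := by
      apply Finset.sum_congr rfl
      intro k hk
      rw [if_neg (by omega : ¬ (-(m:ℤ)) = k)]
      by_cases hkm : k = m
      · subst hkm; simp
      · rw [if_neg (by omega), if_neg hkm]; simp
    rw [e, Finset.sum_ite_eq' (Finset.Icc 1 Q) m]
    unfold cw
    simp only [abs_neg, Nat.abs_cast, Finset.mem_Icc]
    push_cast
    by_cases h2 : 2 * m < w
    · rw [if_pos (by exact_mod_cast h2), if_pos (by omega), if_pos h2, neg_div, ct_neg]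
    · rw [if_neg (by exact_mod_cast h2), if_neg h2]; simp
  · subst h
    have e : ∀ k ∈ Finset.Icc 1 Q, cw k w * ((if (0:ℤ) = k then (1:ℝ) else 0) -
        (if (0:ℤ) = -k then 1 else 0)) = 0 := by
      intro k hk
      rw [Finset.mem_Icc] at hk
      rw [if_neg (by omega), if_neg (by omega)]; simp
    rw [Finset.sum_eq_zero e]
    simp [hct0]
  · obtain ⟨m, rfl⟩ : ∃ m : ℕ, d = m := ⟨d.natAbs, by omega⟩
    have hm : 0 < m := by omega
    have e : ∑ k ∈ Finset.Icc 1 Q, cw k w * ((if (m:ℤ) = k then (1:ℝ) else 0) -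
        (if (m:ℤ) = -k then 1 else 0)) = ∑ k ∈ Finset.Icc 1 Q, if k = m then cw m w else 0 := by
      apply Finset.sum_congr rfl
      intro k hk
      rw [if_neg (by omega : ¬ (m:ℤ) = -k)]
      by_cases hkm : k = m
      · subst hkm; simp
      · rw [if_neg (by omega), if_neg hkm]; simp
    rw [e, Finset.sum_ite_eq' (Finset.Icc 1 Q) m]
    unfold cw
    simp only [Nat.abs_cast, Finset.mem_Icc]
    push_cast
    by_cases h2 : 2 * m < w
    · rw [if_pos (by exact_mod_cast h2), if_pos (by omega), if_pos h2]
    · rw [if_neg (by exact_mod_cast h2), if_neg h2]; simp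

theorem Zp_eq (α : ℝ) (n p a Q : ℕ) :
    Zp α n p a Q = ∑ k ∈ Finset.Icc 1 Q, ∑ w ∈ Finset.Icc a Q,
      cw k w * (cc α n p k w - cc α n p (-k) w) := by
  unfold Zp
  rw [Finset.sum_comm (s := Finset.Icc 1 Q)]
  apply Finset.sum_congr rfl
  intro w hw
  unfold cc
  simp only [← Finset.sum_sub_distrib, Finset.mul_sum]
  rw [Finset.sum_comm (s := Finset.Icc 1 Q)]
  apply Finset.sum_congr rfl
  intro v hv
  rw [term_k _ (Finset.mem_Icc.1 hw).2]
  apply Finset.sum_congr rfl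
  intro k _
  have e1 : ((n:ℤ) * v - p * w = k) ↔ ((n:ℤ) * v = p * w + k) := by constructor <;> intro h <;> linarith
  have e2 : ((n:ℤ) * v - p * w = -k) ↔ ((n:ℤ) * v = p * w + -k) := by constructor <;> intro h <;> linarith
  simp only [e1, e2]

open Classical in
theorem cc_eq {α : ℝ} (hα : α ≤ 1) {n p w : ℕ} (hn : 0 < n) (hp : 0 < p) {k : ℤ} (hk : 2 * |k| < w) :
    cc α n p k w = if ((n:ℤ) ∣ p*w+k ∧ (((p*w+k:ℤ)):ℝ) < α * n * w) then 1 else 0 := by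
  unfold cc
  have hn' : (0:ℝ) < n := by exact_mod_cast hn
  have hw0 : (0:ℤ) < w := by have := abs_nonneg k; omega
  have hk1 := neg_abs_le k
  have hpw : (w:ℤ) ≤ p * w := by
    have : (1:ℤ) ≤ p := by exact_mod_cast hp
    nlinarith
  have hnz : (0:ℤ) < n := by exact_mod_cast hn
  split_ifs with h
  · obtain ⟨⟨u, hu⟩, h2⟩ := h
    have hu0 : 0 ≤ u := by
      by_contra hneg
      push Not at hneg
      nlinarith
    obtain ⟨v, rfl⟩ : ∃ v : ℕ, u = v := ⟨u.toNat, by omega⟩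
    rw [Finset.sum_eq_single v]
    · rw [if_pos hu.symm]
    · intro v' _ hne
      rw [if_neg]
      intro h
      rw [hu] at h
      exact hne (by exact_mod_cast mul_left_cancel₀ hnz.ne' h)
    · intro hv
      exfalso; apply hv
      rw [hu] at h2
      push_cast at h2
      have h3 : (v:ℝ) < α * w := by
        have : (n:ℝ) * v < n * (α * w) := by linarith
        exact lt_of_mul_lt_mul_left this hn'.le
      unfold vset
      rw [Finset.mem_filter, Finset.mem_range]
      refine ⟨?_, h3⟩
      have hwr : (0:ℝ) < w := by exact_mod_cast hw0
      have : (v:ℝ) < w := by nlinarith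
      exact_mod_cast this
  · apply Finset.sum_eq_zero
    intro v hv
    rw [if_neg]
    intro h'
    apply h
    refine ⟨⟨v, h'.symm⟩, ?_⟩
    rw [← h']
    push_cast
    have := (Finset.mem_filter.1 hv).2
    have h4 : (n:ℝ) * v < n * (α * w) := mul_lt_mul_of_pos_left this hn'
    linarith

theorem cc_le {α : ℝ} (hα : α ≤ 1) {n p w : ℕ} (hn : 0 < n) (hp : 0 < p) {k : ℤ} (hk : 2 * |k| < w) :
    0 ≤ cc α n p k w ∧ cc α n p k w ≤ bb n p k w := by
  classical
  rw [cc_eq hα hn hp hk]; unfold bb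
  by_cases h1 : (n:ℤ) ∣ p*w+k
  · rw [if_pos h1]; split_ifs <;> norm_num
  · rw [if_neg h1, if_neg (fun h => h1 h.1)]; simp

theorem cw_zero {k w : ℕ} (h : ¬ 2 * k < w) : cw k w = 0 := by unfold cw; rw [if_neg h]

theorem Zp_abs {α : ℝ} (hα : α ≤ 1) {n p : ℕ} (hn : 0 < n) (hp : 0 < p) (a Q : ℕ) :
    |Zp α n p a Q| ≤ 2 * (Q * (1 + Real.log Q) * ((Q + 1) / n + 1)) := by
  rw [Zp_eq]
  have h1 := Zabs_le hn p a Q 1 (Or.inl rfl)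
  have h2 := Zabs_le hn p a Q (-1) (Or.inr rfl)
  calc _ ≤ ∑ k ∈ Finset.Icc 1 Q, ∑ w ∈ Finset.Icc a Q, (cw k w * bb n p (1 * k) w +
        cw k w * bb n p (-1 * k) w) := by
        refine (Finset.abs_sum_le_sum_abs _ _).trans (Finset.sum_le_sum ?_)
        intro k hk
        have hk0 := (Finset.mem_Icc.1 hk).1
        refine (Finset.abs_sum_le_sum_abs _ _).trans (Finset.sum_le_sum ?_)
        intro w hw
        by_cases h : 2 * k < w
        · have c1 := cc_le (k := k) hα hn hp (w := w) (by simp only [Nat.abs_cast]; exact_mod_cast h)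
          have c2 := cc_le (k := -k) hα hn hp (w := w) (by simp only [abs_neg, Nat.abs_cast]; exact_mod_cast h)
          rw [abs_mul, abs_of_nonneg (cw_nonneg (by omega) w), ← mul_add, one_mul, neg_one_mul]
          apply mul_le_mul_of_nonneg_left _ (cw_nonneg (by omega) w)
          rw [abs_le]; constructor <;> linarith [c1.1, c1.2, c2.1, c2.2]
        · rw [cw_zero h]; simp
    _ ≤ _ := by simp only [Finset.sum_add_distrib]; linarith

theorem Zp_full {α : ℝ} (hα : α ≤ 1) {n p : ℕ} (hn : 0 < n) (hp : 0 < p) (a Q : ℕ)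
    (h : (p:ℝ) + 1/2 ≤ α * n) : |Zp α n p a Q| ≤ Q * (1 + Real.log Q) := by
  classical
  have : Zp α n p a Q = Zsym n p a Q := by
    rw [Zp_eq]; unfold Zsym
    apply Finset.sum_congr rfl
    intro k hk
    apply Finset.sum_congr rfl
    intro w hw
    by_cases h2 : 2 * k < w
    · have h2' : 2 * (k:ℝ) < w := by exact_mod_cast h2
      have hk0 : (0:ℝ) ≤ k := by positivity
      rw [cc_eq hα hn hp (by simp only [Nat.abs_cast]; exact_mod_cast h2),
        cc_eq hα hn hp (by simp only [abs_neg, Nat.abs_cast]; exact_mod_cast h2)]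
      have i1 : (((p*w+k:ℤ)):ℝ) < α * n * w := by push_cast; nlinarith
      have i2 : (((p*w+-k:ℤ)):ℝ) < α * n * w := by push_cast; nlinarith
      unfold bb
      simp only [i1, i2, and_true]
    · rw [cw_zero h2]; simp
  rw [this]; exact Zsym_le hn p a Q

theorem Zp_zero {α : ℝ} (hα : α ≤ 1) {n p : ℕ} (hn : 0 < n) (hp : 0 < p) (a Q : ℕ)
    (h : α * n + 1/2 ≤ p) : Zp α n p a Q = 0 := by
  classical
  rw [Zp_eq]
  apply Finset.sum_eq_zero
  intro k hk
  apply Finset.sum_eq_zero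
  intro w hw
  by_cases h2 : 2 * k < w
  · have h2' : 2 * (k:ℝ) < w := by exact_mod_cast h2
    have hk0 : (0:ℝ) ≤ k := by positivity
    rw [cc_eq hα hn hp (by simp only [Nat.abs_cast]; exact_mod_cast h2),
      cc_eq hα hn hp (by simp only [abs_neg, Nat.abs_cast]; exact_mod_cast h2)]
    rw [if_neg, if_neg]
    · simp
    · rintro ⟨-, h3⟩; push_cast at h3; nlinarith
    · rintro ⟨-, h3⟩; push_cast at h3; nlinarith
  · rw [cw_zero h2]; simp

theorem Zp_theta {α : ℝ} (hα : α ≤ 1) {n p : ℕ} (hn : 0 < n) (hp : 0 < p) (a Q : ℕ)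
    (h : (p:ℝ) ≠ α * n) : |Zp α n p a Q| ≤ Q * (1 + Real.log Q) + (Q+1)^2 / |α * n - p| := by
  classical
  set θ := |α * n - p| with hθ
  have hθ0 : 0 < θ := abs_pos.2 (fun h' => h (by linarith))
  have hcw : ∀ k ∈ Finset.Icc 1 Q, ∀ w : ℕ, 2 * k < w → θ * w ≤ k → cw k w ≤ 1 / θ := by
    intro k hk w h2 h3
    have hk0 : (0:ℝ) < k := by exact_mod_cast (Finset.mem_Icc.1 hk).1
    refine (cw_le (Finset.mem_Icc.1 hk).1 w).trans ?_
    rw [div_le_div_iff₀ (by positivity) hθ0]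
    nlinarith [Real.pi_gt_three]
  have hsum : ∀ f : ℕ → ℕ → ℝ, (∀ k ∈ Finset.Icc 1 Q, ∀ w ∈ Finset.Icc a Q, |f k w| ≤ 1/θ) →
      |∑ k ∈ Finset.Icc 1 Q, ∑ w ∈ Finset.Icc a Q, f k w| ≤ (Q+1)^2/θ := by
    intro f hf
    calc _ ≤ ∑ k ∈ Finset.Icc 1 Q, ∑ w ∈ Finset.Icc a Q, 1/θ := by
          refine (Finset.abs_sum_le_sum_abs _ _).trans (Finset.sum_le_sum fun k hk => ?_)
          exact (Finset.abs_sum_le_sum_abs _ _).trans (Finset.sum_le_sum fun w hw => hf k hk w hw)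
      _ = (Q:ℝ) * (((Q + 1 - a : ℕ):ℝ) * (1/θ)) := by simp
      _ ≤ (Q+1:ℝ) * ((Q+1:ℕ) * (1/θ)) := by gcongr; linarith; omega
      _ = _ := by push_cast; ring
  rcases lt_or_gt_of_ne h with hlt | hgt
  · have hθe : θ = α * n - p := by rw [hθ, abs_of_pos (by linarith)]
    have e : Zp α n p a Q = Zsym n p a Q + ∑ k ∈ Finset.Icc 1 Q, ∑ w ∈ Finset.Icc a Q,
        cw k w * (cc α n p k w - bb n p k w) := by
      rw [Zp_eq]; unfold Zsym
      rw [← Finset.sum_add_distrib]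
      apply Finset.sum_congr rfl
      intro k hk
      have hk0 : (0:ℝ) < k := by exact_mod_cast (Finset.mem_Icc.1 hk).1
      rw [← Finset.sum_add_distrib]
      apply Finset.sum_congr rfl
      intro w hw
      by_cases h2 : 2 * k < w
      · have : cc α n p (-k) w = bb n p (-k) w := by
          rw [cc_eq hα hn hp (by simp only [abs_neg, Nat.abs_cast]; exact_mod_cast h2)]
          have hw0 : (0:ℝ) ≤ w := by positivity
          have i2 : (((p*w+-k:ℤ)):ℝ) < α * n * w := by push_cast; nlinarith
          unfold bb
          simp only [i2, and_true]
        rw [this]; ring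
      · rw [cw_zero h2]; simp
    rw [e]
    refine (abs_add_le _ _).trans (add_le_add (Zsym_le hn p a Q) (hsum _ ?_))
    intro k hk w hw
    by_cases h2 : 2 * k < w
    · have c1 := cc_le (k := k) hα hn hp (w := w) (by simp only [Nat.abs_cast]; exact_mod_cast h2)
      have hnn := cw_nonneg (Finset.mem_Icc.1 hk).1 w
      by_cases h3 : θ * w ≤ k
      · have h4 := hcw k hk w h2 h3
        have hb1 : bb n p k w ≤ 1 := by unfold bb; split_ifs <;> norm_num
        rw [abs_mul, abs_of_nonneg hnn]
        calc _ ≤ cw k w * 1 := by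
              apply mul_le_mul_of_nonneg_left _ hnn
              rw [abs_le]; constructor <;> linarith [c1.1, c1.2]
          _ ≤ _ := by linarith
      · have : cc α n p k w = bb n p k w := by
          rw [cc_eq hα hn hp (by simp only [Nat.abs_cast]; exact_mod_cast h2)]
          have i2 : (((p*w+k:ℤ)):ℝ) < α * n * w := by
            push_cast; push Not at h3; rw [hθe] at h3; nlinarith
          unfold bb
          simp only [i2, and_true]
        rw [this]; simp; positivity
    · rw [cw_zero h2]; simp; positivity
  · have hθe : θ = p - α * n := by rw [hθ, abs_of_neg (by linarith)]; ring
    rw [Zp_eq]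
    have hl : 0 ≤ Real.log Q := Real.log_natCast_nonneg Q
    have : 0 ≤ (Q:ℝ) * (1 + Real.log Q) := by positivity
    refine (hsum _ ?_).trans (by linarith)
    intro k hk w hw
    have hk0 : (0:ℝ) < k := by exact_mod_cast (Finset.mem_Icc.1 hk).1
    by_cases h2 : 2 * k < w
    · have c1 := cc_le (k := -k) hα hn hp (w := w) (by simp only [abs_neg, Nat.abs_cast]; exact_mod_cast h2)
      have hnn := cw_nonneg (Finset.mem_Icc.1 hk).1 w
      have hw0 : (0:ℝ) ≤ w := by positivity
      have z : cc α n p k w = 0 := by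
        rw [cc_eq hα hn hp (by simp only [Nat.abs_cast]; exact_mod_cast h2), if_neg]
        rintro ⟨-, h3⟩; push_cast at h3; nlinarith
      rw [z, zero_sub]
      by_cases h3 : θ * w ≤ k
      · have h4 := hcw k hk w h2 h3
        have hb1 : bb n p (-k) w ≤ 1 := by unfold bb; split_ifs <;> norm_num
        rw [abs_mul, abs_of_nonneg hnn, abs_neg, abs_of_nonneg c1.1]
        calc _ ≤ cw k w * 1 := by
              apply mul_le_mul_of_nonneg_left _ hnn
              linarith [c1.2]
          _ ≤ _ := by linarith
      · have : cc α n p (-k) w = 0 := by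
          rw [cc_eq hα hn hp (by simp only [abs_neg, Nat.abs_cast]; exact_mod_cast h2), if_neg]
          rintro ⟨-, h4⟩; push_cast at h4; push Not at h3; rw [hθe] at h3; nlinarith
        rw [this]; simp; positivity
    · rw [cw_zero h2]; simp; positivity

section
open Filter Topology


theorem cw_zero_left (w : ℕ) : cw 0 w = 0 := by
  have hct0 : ct 0 = 0 := by simpa using ct_int 0
  unfold cw; simp [hct0]

theorem Z0_eq (α : ℝ) (n a Q : ℕ) :
    Zp α n 0 a Q = ∑ w ∈ Finset.Icc a Q, ∑ v ∈ vset α w, cw (n*v) w := by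
  unfold Zp
  apply Finset.sum_congr rfl
  intro w _
  apply Finset.sum_congr rfl
  intro v _
  unfold cw
  have e : (n:ℤ) * v - (0:ℕ) * w = ((n * v : ℕ):ℤ) := by push_cast; ring
  rw [e, Nat.abs_cast]
  have e2 : (2 * ((n*v:ℕ):ℤ) < w) ↔ (2 * (n * v) < w) := by
    constructor <;> intro h <;> exact_mod_cast h
  simp only [e2]
  simp

theorem cw_nonneg' (k w : ℕ) : 0 ≤ cw k w := by
  rcases Nat.eq_zero_or_pos k with h | h
  · subst h; rw [cw_zero_left]
  · exact cw_nonneg h w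

theorem Z0_nonneg (α : ℝ) (n a Q : ℕ) : 0 ≤ Zp α n 0 a Q := by
  rw [Z0_eq]
  exact Finset.sum_nonneg fun w _ => Finset.sum_nonneg fun v _ => cw_nonneg' _ _

theorem sum_id_Icc (Q : ℕ) : ∑ w ∈ Finset.Icc 1 Q, (w:ℝ) = Q * (Q+1)/2 := by
  induction Q with
  | zero => simp
  | succ n ih => rw [Finset.sum_Icc_succ_top (by omega), ih]; push_cast; ring

theorem Z0_le (α : ℝ) {n : ℕ} (hn : 0 < n) (a Q : ℕ) :
    Zp α n 0 a Q ≤ (Q * (Q+1)/2) * (1 + Real.log Q) / (Real.pi * n) := by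
  have hn' : (0:ℝ) < n := by exact_mod_cast hn
  have hpi := Real.pi_pos
  rw [Z0_eq]
  have hl : 0 ≤ Real.log Q := Real.log_natCast_nonneg Q
  have inner : ∀ w ∈ Finset.Icc a Q, ∑ v ∈ vset α w, cw (n*v) w ≤
      w * ((1 + Real.log Q) / (Real.pi * n)) := by
    intro w hw
    rw [Finset.mem_Icc] at hw
    have hs : vset α w ⊆ insert 0 (Finset.Icc 1 Q) := by
      intro v hv
      have := Finset.mem_range.1 (Finset.mem_filter.1 hv).1
      rw [Finset.mem_insert, Finset.mem_Icc]; omega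
    refine (Finset.sum_le_sum_of_subset_of_nonneg hs (fun _ _ _ => cw_nonneg' _ _)).trans ?_
    rw [Finset.sum_insert (by simp), Nat.mul_zero, cw_zero_left, zero_add]
    calc _ ≤ ∑ v ∈ Finset.Icc 1 Q, (w / (Real.pi * n)) * ((1:ℝ)/v) := by
          apply Finset.sum_le_sum
          intro v hv
          have hv0 := (Finset.mem_Icc.1 hv).1
          have hv' : (0:ℝ) < v := by exact_mod_cast hv0
          refine (cw_le (Nat.mul_pos hn hv0) w).trans ?_
          apply le_of_eq; push_cast; field_simp
      _ = (w / (Real.pi * n)) * ∑ v ∈ Finset.Icc 1 Q, ((1:ℝ)/v) := by rw [Finset.mul_sum]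
      _ ≤ (w / (Real.pi * n)) * (1 + Real.log Q) := by gcongr; exact hsum_le Q
      _ = _ := by ring
  refine (Finset.sum_le_sum inner).trans ?_
  rw [← Finset.sum_mul]
  have h1 : ∑ w ∈ Finset.Icc a Q, (w:ℝ) ≤ Q * (Q+1)/2 := by
    rw [← sum_id_Icc]
    calc _ ≤ ∑ w ∈ insert 0 (Finset.Icc 1 Q), (w:ℝ) := by
          apply Finset.sum_le_sum_of_subset_of_nonneg
          · intro w hw
            rw [Finset.mem_insert]; rw [Finset.mem_Icc] at hw ⊢; omega
          · intros; positivity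
      _ = _ := by rw [Finset.sum_insert (by simp)]; simp
  calc _ ≤ (Q * (Q+1)/2:ℝ) * ((1 + Real.log Q) / (Real.pi * n)) := by gcongr
    _ = _ := by ring

theorem Z0_ge {α : ℝ} (hα : 0 < α) {n : ℕ} (hn : 0 < n) {a : ℕ} (ha : 0 < a) :
    ∃ c : ℝ, 0 < c ∧ ∀ Q : ℕ, 0 ≤ Real.log c + Real.log Q →
      (Real.log c + Real.log Q) / (Real.pi * n) * ((Q:ℝ)^2/2 - a^2) - 2 * (Q:ℝ)^2 ≤
        Zp α n 0 a Q := by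
  have hn' : (0:ℝ) < n := by exact_mod_cast hn
  have hn1 : (1:ℝ) ≤ n := by exact_mod_cast hn
  have hpi := Real.pi_gt_three
  set c := min (α/2) (1/(4*n)) with hc
  have hc0 : 0 < c := by positivity
  have hc1 : c ≤ α/2 := min_le_left _ _
  have hc2 : c ≤ 1/(4*n) := min_le_right _ _
  have hc2' : c * (4 * n) ≤ 1 := by rw [le_div_iff₀ (by positivity)] at hc2; exact hc2
  refine ⟨c, hc0, ?_⟩
  intro Q hQ
  rw [Z0_eq]
  have inner : ∀ w ∈ Finset.Icc a Q, (Real.log c + Real.log Q) / (Real.pi * n) * w - 2 * Q ≤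
      ∑ v ∈ vset α w, cw (n*v) w := by
    intro w hw
    rw [Finset.mem_Icc] at hw
    have hw0 : (0:ℝ) < w := by exact_mod_cast (by omega : 0 < w)
    have hwQ : (w:ℝ) ≤ Q := by exact_mod_cast hw.2
    set V := ⌊c * w⌋₊ with hV
    have hV1 : (V:ℝ) ≤ c * w := Nat.floor_le (by positivity)
    have hV2 : c * w < V + 1 := Nat.lt_floor_add_one _
    have hVw : ∀ v ∈ Finset.Icc 1 V, 0 < (v:ℝ) ∧ (v:ℝ) ≤ c * w ∧ 4 * (n * (v:ℝ)) ≤ w := by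
      intro v hv
      rw [Finset.mem_Icc] at hv
      have h1 : (0:ℝ) < v := by exact_mod_cast hv.1
      have h2 : (v:ℝ) ≤ V := by exact_mod_cast hv.2
      refine ⟨h1, by linarith, ?_⟩
      have h3 : 4 * (n * (v:ℝ)) ≤ 4 * (n * (c * w)) := by gcongr; linarith
      nlinarith
    have hs : Finset.Icc 1 V ⊆ vset α w := by
      intro v hv
      obtain ⟨h1, h2, h3⟩ := hVw v hv
      unfold vset
      rw [Finset.mem_filter, Finset.mem_range]
      constructor
      · have : (v:ℝ) < w := by nlinarith
        exact_mod_cast this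
      · nlinarith
    have hVle : (V:ℝ) ≤ w := by nlinarith
    calc _ ≤ (w / (Real.pi * n)) * Real.log ((V:ℝ)+1) - V := by
          have h1 : Real.log c + Real.log w ≤ Real.log ((V:ℝ)+1) := by
            rw [← Real.log_mul hc0.ne' hw0.ne']
            exact Real.log_le_log (by positivity) hV2.le
          have h2 : (w / (Real.pi * n)) * (Real.log c + Real.log w) ≤
              (w / (Real.pi * n)) * Real.log ((V:ℝ)+1) := by gcongr
          have h3 : w * Real.log Q - Q ≤ w * Real.log w := by
            have h4 : Real.log (Q/w) ≤ Q/w := (Real.log_le_sub_one_of_pos (div_pos (by linarith) hw0)).trans (by linarith)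
            rw [Real.log_div (by linarith) hw0.ne'] at h4
            have h5 : w * (Real.log Q - Real.log w) ≤ w * (Q/w) := by gcongr
            rw [mul_div_cancel₀ _ hw0.ne'] at h5
            linarith
          have h6 : (Real.log c + Real.log Q) / (Real.pi * n) * w - (1/(Real.pi*n)) * Q ≤
             (w / (Real.pi * n)) * (Real.log c + Real.log w) := by
            have : (1/(Real.pi*n)) * (w * Real.log Q - Q) ≤ (1/(Real.pi*n)) * (w * Real.log w) := by gcongr
            have e1 : (w / (Real.pi * n)) * (Real.log c + Real.log w) =
               (1/(Real.pi*n)) * (w * Real.log w) + (1/(Real.pi*n)) * (w * Real.log c) := by ring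
            have e2 : (Real.log c + Real.log Q) / (Real.pi * n) * w - (1/(Real.pi*n)) * Q =
               (1/(Real.pi*n)) * (w * Real.log Q - Q) + (1/(Real.pi*n)) * (w * Real.log c) := by ring
            rw [e1, e2]; linarith
          have h7 : (1/(Real.pi*n)) * Q ≤ Q := by
            have : 1/(Real.pi*n) ≤ 1 := by
              rw [div_le_one (by positivity)]; nlinarith
            nlinarith
          linarith
      _ ≤ (w / (Real.pi * n)) * ∑ v ∈ Finset.Icc 1 V, ((1:ℝ)/v) - V := by
          gcongr; exact le_hsum V
      _ = ∑ v ∈ Finset.Icc 1 V, ((w / (Real.pi * n)) * ((1:ℝ)/v) - 1) := by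
          rw [Finset.sum_sub_distrib, ← Finset.mul_sum]; simp
      _ ≤ ∑ v ∈ Finset.Icc 1 V, cw (n*v) w := by
          apply Finset.sum_le_sum
          intro v hv
          obtain ⟨h1, h2, h3⟩ := hVw v hv
          have hlt : 2 * (n * v) < w := by
            have : 2 * (n * (v:ℝ)) < w := by
              have : 0 < n * (v:ℝ) := by positivity
              linarith
            exact_mod_cast this
          unfold cw
          rw [if_pos hlt]
          have hx : ((n * v : ℕ):ℝ)/w ≤ 1/2 := by
            rw [div_le_div_iff₀ hw0 (by norm_num)]; push_cast; nlinarith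
          have hx0 : 0 < ((n * v : ℕ):ℝ)/w := by push_cast; positivity
          have h5 := le_ct hx0 hx
          have e1 : 1 / (Real.pi * (((n * v : ℕ):ℝ)/w)) = (w / (Real.pi * n)) * ((1:ℝ)/v) := by
            push_cast; field_simp
          rw [e1] at h5
          nlinarith [Real.pi_le_four]
      _ ≤ _ := Finset.sum_le_sum_of_subset_of_nonneg hs (fun _ _ _ => cw_nonneg' _ _)
  refine le_trans ?_ (Finset.sum_le_sum inner)
  rw [Finset.sum_sub_distrib, ← Finset.mul_sum]
  apply sub_le_sub
  · apply mul_le_mul_of_nonneg_left _ (by positivity)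
    have h1 := sum_id_Icc Q
    have h2 : ∑ w ∈ Finset.Icc 1 Q, (w:ℝ) ≤ ∑ w ∈ Finset.Icc a Q, (w:ℝ) + ∑ w ∈ Finset.range a, (w:ℝ) := by
      calc _ ≤ ∑ w ∈ Finset.Icc a Q ∪ Finset.range a, (w:ℝ) := by
            apply Finset.sum_le_sum_of_subset_of_nonneg
            · intro w hw
              rw [Finset.mem_union, Finset.mem_range]; rw [Finset.mem_Icc] at hw ⊢; omega
            · intros; positivity
        _ ≤ _ := by
            rw [Finset.sum_union]
            rw [Finset.disjoint_left]
            intro w hw hw'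
            rw [Finset.mem_range] at hw'; rw [Finset.mem_Icc] at hw; omega
    have h3 : ∑ w ∈ Finset.range a, (w:ℝ) ≤ (a:ℝ)^2 := by
      calc _ ≤ ∑ w ∈ Finset.range a, (a:ℝ) := by
            apply Finset.sum_le_sum; intro w hw
            rw [Finset.mem_range] at hw; exact_mod_cast hw.le
        _ = _ := by simp; ring
    have : (0:ℝ) ≤ Q := by positivity
    nlinarith
  · simp only [Finset.sum_const, nsmul_eq_mul, Nat.card_Icc]
    have : ((Q + 1 - a : ℕ):ℝ) ≤ Q := by exact_mod_cast (by omega)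
    nlinarith [(Nat.cast_nonneg Q : (0:ℝ) ≤ Q)]

theorem tlog : Tendsto (fun Q : ℕ => Real.log (Q:ℝ)) atTop atTop :=
  Real.tendsto_log_atTop.comp tendsto_natCast_atTop_atTop

theorem tlog_inv (c : ℝ) : Tendsto (fun Q : ℕ => c / Real.log (Q:ℝ)) atTop (𝓝 0) :=
  tlog.const_div_atTop c

theorem tinv (c : ℝ) : Tendsto (fun Q : ℕ => c / (Q:ℝ)) atTop (𝓝 0) :=
  (tendsto_natCast_atTop_atTop (R := ℝ)).const_div_atTop c

theorem Z0_lim {α : ℝ} (hα : 0 < α) {n : ℕ} (hn : 0 < n) {a : ℕ} (ha : 0 < a) :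
    Tendsto (fun Q : ℕ => Zp α n 0 a Q / ((Q:ℝ)^2 * Real.log Q)) atTop (𝓝 (1/(2*Real.pi*n))) := by
  have hn' : (0:ℝ) < n := by exact_mod_cast hn
  have hpi := Real.pi_pos
  obtain ⟨c, hc, hlow⟩ := Z0_ge hα hn ha
  have hev : ∀ᶠ Q : ℕ in atTop, 0 ≤ Real.log c + Real.log Q ∧ 0 < Real.log (Q:ℝ) ∧ 0 < (Q:ℝ) := by
    filter_upwards [tlog.eventually_ge_atTop (-Real.log c), tlog.eventually_gt_atTop 0,
      eventually_gt_atTop 0] with Q h1 h2 h3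
    exact ⟨by linarith, h2, by exact_mod_cast h3⟩
  have lo : Tendsto (fun Q : ℕ => (1 + Real.log c / Real.log Q) / (Real.pi * n) *
      (1/2 - (a:ℝ)/Q * (a/Q)) - 2 / Real.log Q) atTop (𝓝 (1/(2*Real.pi*n))) := by
    have := ((((tlog_inv (Real.log c)).const_add 1).div_const (Real.pi * n)).mul
      (((tinv a).mul (tinv a)).const_sub (1/2))).sub (tlog_inv 2)
    convert this using 2
    field_simp; ring
  have up : Tendsto (fun Q : ℕ => (1/2 * (1 + 1/(Q:ℝ))) * (1 + 1 / Real.log Q) / (Real.pi * n))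
      atTop (𝓝 (1/(2*Real.pi*n))) := by
    have := ((((tinv 1).const_add 1).const_mul (1/2)).mul ((tlog_inv 1).const_add 1)).div_const (Real.pi * n)
    convert this using 2
    field_simp; ring
  refine tendsto_of_tendsto_of_tendsto_of_le_of_le' lo up ?_ ?_
  · filter_upwards [hev] with Q ⟨h1, h2, h3⟩
    rw [le_div_iff₀ (by positivity)]
    refine le_trans (le_of_eq ?_) (hlow Q h1)
    field_simp
    ring
  · filter_upwards [hev] with Q ⟨h1, h2, h3⟩
    rw [div_le_iff₀ (by positivity)]
    refine (Z0_le α hn a Q).trans (le_of_eq ?_)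
    field_simp
    ring

end

section
open Filter Topology


open Classical in
noncomputable def lset (α : ℝ) (n : ℕ) : Finset ℕ :=
  (Finset.Icc 1 n).filter (fun p : ℕ => |α * n - p| < 1/2)

noncomputable def leftN (α : ℝ) (n a Q : ℕ) : ℝ := ∑ p ∈ lset α n, Zp α n p a Q

theorem Zp_empty (α : ℝ) (n p a Q : ℕ) (h : Q < a) : Zp α n p a Q = 0 := by
  unfold Zp
  rw [Finset.Icc_eq_empty (by omega)]; simp

theorem lset_card (α : ℝ) (n : ℕ) : (lset α n).card ≤ 1 := by
  rw [Finset.card_le_one]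
  intro p hp q hq
  have h1 := abs_lt.1 (Finset.mem_filter.1 hp).2
  have h2 := abs_lt.1 (Finset.mem_filter.1 hq).2
  have h3 : (p:ℝ) < q + 1 := by linarith [h1.1, h1.2, h2.1, h2.2]
  have h4 : (q:ℝ) < p + 1 := by linarith [h1.1, h1.2, h2.1, h2.2]
  have h3' : p < q + 1 := by exact_mod_cast h3
  have h4' : q < p + 1 := by exact_mod_cast h4
  omega

theorem leftN_le {α : ℝ} (hα : α ≤ 1) {n : ℕ} (hn : 0 < n) (a Q : ℕ) :
    |leftN α n a Q| ≤ 2 * (Q * (1 + Real.log Q) * ((Q + 1) / n + 1)) := by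
  unfold leftN
  have hl : 0 ≤ Real.log Q := Real.log_natCast_nonneg Q
  refine (Finset.abs_sum_le_sum_abs _ _).trans ?_
  calc _ ≤ ∑ p ∈ lset α n, 2 * (Q * (1 + Real.log Q) * ((Q + 1) / n + 1)) := by
        apply Finset.sum_le_sum
        intro p hp
        exact Zp_abs hα hn (Finset.mem_Icc.1 (Finset.mem_filter.1 hp).1).1 a Q
    _ = ((lset α n).card : ℝ) * (2 * (Q * (1 + Real.log Q) * ((Q + 1) / n + 1))) := by simp
    _ ≤ 1 * (2 * (Q * (1 + Real.log Q) * ((Q + 1) / n + 1))) := by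
        gcongr; exact_mod_cast lset_card α n
    _ = _ := one_mul _

theorem Yn_dec {α : ℝ} (hα : α ≤ 1) {n : ℕ} (hn : 0 < n) (L Q : ℕ) :
    |Yn α L Q n - (Zp α n 0 (L*n) Q + leftN α n (L*n) Q)| ≤ n * (Q * (1 + Real.log Q)) := by
  classical
  rw [Yn_eq]
  have hr : Finset.range (n+1) = insert 0 (Finset.Icc 1 n) := by
    ext x; rw [Finset.mem_range, Finset.mem_insert, Finset.mem_Icc]; omega
  rw [hr, Finset.sum_insert (by simp)]
  have hl : 0 ≤ Real.log Q := Real.log_natCast_nonneg Q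
  have e := Finset.sum_filter_add_sum_filter_not (Finset.Icc 1 n) (fun p : ℕ => |α * n - p| < 1/2)
    (fun p => Zp α n p (L*n) Q)
  have e2 : leftN α n (L*n) Q = ∑ p ∈ (Finset.Icc 1 n).filter (fun p : ℕ => |α * n - p| < 1/2),
      Zp α n p (L*n) Q := by unfold leftN lset; congr!
  rw [← e, e2]
  rw [show ∀ A B C : ℝ, A + (B + C) - (A + B) = C by intros; ring]
  refine (Finset.abs_sum_le_sum_abs _ _).trans ?_
  calc _ ≤ ∑ p ∈ (Finset.Icc 1 n).filter (fun p : ℕ => ¬ |α * n - p| < 1/2), (Q * (1 + Real.log Q)) := by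
        apply Finset.sum_le_sum
        intro p hp
        rw [Finset.mem_filter, Finset.mem_Icc] at hp
        obtain ⟨⟨h1, h2⟩, h3⟩ := hp
        push Not at h3
        rcases le_abs.1 h3 with h | h
        · exact Zp_full hα hn h1 _ _ (by linarith)
        · rw [Zp_zero hα hn h1 _ _ (by linarith)]; simp; positivity
    _ ≤ ∑ p ∈ Finset.Icc 1 n, ((Q:ℝ) * (1 + Real.log Q)) :=
        Finset.sum_le_sum_of_subset_of_nonneg (Finset.filter_subset _ _) (fun _ _ _ => by positivity)
    _ = _ := by simp

theorem leftN_lim {α : ℝ} (hα : α ≤ 1) (hirr : Irrational α) {n : ℕ} (hn : 0 < n) (a : ℕ) :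
    Tendsto (fun Q : ℕ => leftN α n a Q / ((Q:ℝ)^2 * Real.log Q)) atTop (𝓝 0) := by
  have h : ∀ p ∈ lset α n, Tendsto (fun Q : ℕ => Zp α n p a Q / ((Q:ℝ)^2 * Real.log Q)) atTop (𝓝 0) := by
    intro p hp
    have hp1 := (Finset.mem_Icc.1 (Finset.mem_filter.1 hp).1).1
    have hne : (p:ℝ) ≠ α * n := by
      intro h
      have := hirr.mul_natCast hn.ne'
      rw [← h] at this
      exact this.ne_nat p rfl
    set θ := |α * n - p| with hθ
    have hθ0 : 0 < θ := abs_pos.2 (fun h' => hne (by linarith))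
    have lim : Tendsto (fun Q : ℕ => 1/(Q:ℝ) * (1 + 1 / Real.log Q) + (1 + 1/(Q:ℝ))^2 * ((1/θ) / Real.log Q))
        atTop (𝓝 0) := by
      have := ((tinv 1).mul ((tlog_inv 1).const_add 1)).add ((((tinv 1).const_add 1).pow 2).mul (tlog_inv (1/θ)))
      convert this using 2
      simp
    refine squeeze_zero_norm' ?_ lim
    filter_upwards [tlog.eventually_gt_atTop 0, eventually_gt_atTop 0] with Q h2 h3
    have h3' : (0:ℝ) < Q := by exact_mod_cast h3
    rw [Real.norm_eq_abs, abs_div, abs_of_pos (by positivity : 0 < (Q:ℝ)^2 * Real.log Q),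
      div_le_iff₀ (by positivity)]
    refine (Zp_theta hα hn hp1 a Q hne).trans (le_of_eq ?_)
    rw [← hθ]
    field_simp
    ring
  have := tendsto_finsetSum (lset α n) h
  simp only [Finset.sum_const_zero] at this
  refine this.congr ?_
  intro Q; unfold leftN; rw [Finset.sum_div]

noncomputable def gQ (α : ℝ) (L Q n : ℕ) : ℝ :=
  1/(2*Real.pi*n) * ((Zp α n 0 (L*n) Q + leftN α n (L*n) Q) / ((Q:ℝ)^2 * Real.log Q))

theorem leftN_empty (α : ℝ) (n a Q : ℕ) (h : Q < a) : leftN α n a Q = 0 := by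
  unfold leftN
  exact Finset.sum_eq_zero (fun p _ => Zp_empty α n p a Q h)

theorem gQ_zero {α : ℝ} {L : ℕ} (hL : 1 ≤ L) {Q n : ℕ} (h : n ∉ Finset.Icc 1 Q) : gQ α L Q n = 0 := by
  unfold gQ
  rw [Finset.mem_Icc] at h
  rcases Nat.eq_zero_or_pos n with h0 | h0
  · subst h0; simp
  · have : Q < L * n := by nlinarith [show Q < n by omega]
    rw [Zp_empty _ _ _ _ _ this, leftN_empty _ _ _ _ this]; simp

theorem gQ_bound {α : ℝ} (hα : α ≤ 1) {L : ℕ} (hL : 1 ≤ L) {Q : ℕ} (hQ : 1 ≤ Real.log (Q:ℝ)) (n : ℕ) :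
    ‖gQ α L Q n‖ ≤ 3 * (1 / (n:ℝ)^2) := by
  by_cases h : n ∈ Finset.Icc 1 Q
  swap
  · rw [gQ_zero hL h]; simp
  rw [Finset.mem_Icc] at h
  have hn : (0:ℝ) < n := by exact_mod_cast h.1
  have hnQ : (n:ℝ) ≤ Q := by exact_mod_cast h.2
  have hQ1 : (1:ℝ) ≤ Q := by exact_mod_cast (by omega : 1 ≤ Q)
  have hpi := Real.pi_gt_three
  have hQ0 : (0:ℝ) < Q := by linarith
  set l := Real.log (Q:ℝ) with hl
  have h1 : |Zp α n 0 (L*n) Q| ≤ Q^2 * l / n := by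
    rw [abs_of_nonneg (Z0_nonneg _ _ _ _)]
    refine (Z0_le α h.1 _ Q).trans ?_
    calc (Q * (Q+1)/2:ℝ) * (1 + l) / (Real.pi * n) ≤ (Q * (Q+Q)/2) * (l + l) / (2 * n) := by
          gcongr; linarith
      _ = _ := by field_simp; ring
  have h2 : |leftN α n (L*n) Q| ≤ 12 * (Q^2 * l / n) := by
    refine (leftN_le hα h.1 _ Q).trans ?_
    have : (1:ℝ) ≤ Q / n := by rw [le_div_iff₀ hn]; linarith
    calc 2 * (Q * (1 + l) * ((Q + 1) / n + 1)) ≤ 2 * (Q * (l + l) * ((Q + Q) / n + Q/n)) := by gcongr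
      _ = _ := by field_simp; ring
  unfold gQ
  rw [Real.norm_eq_abs, abs_mul, abs_of_pos (by positivity : 0 < 1/(2*Real.pi*n)), abs_div,
    abs_of_pos (by positivity : 0 < (Q:ℝ)^2 * l)]
  calc _ ≤ 1/(2*3*(n:ℝ)) * ((Q^2 * l / n + 12 * (Q^2 * l / n)) / ((Q:ℝ)^2 * l)) := by
        gcongr
        exact (abs_add_le _ _).trans (add_le_add h1 h2)
    _ = (13/6) * (1/(n:ℝ)^2) := by field_simp; norm_num
    _ ≤ _ := by gcongr; norm_num

theorem gQ_lim {α : ℝ} (h0 : 0 < α) (hα : α ≤ 1) (hirr : Irrational α) {L : ℕ} (hL : 1 ≤ L) :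
    Tendsto (fun Q : ℕ => ∑ n ∈ Finset.Icc 1 Q, gQ α L Q n) atTop (𝓝 (1/24)) := by
  have key : Tendsto (fun Q : ℕ => ∑' n : ℕ, gQ α L Q n) atTop
      (𝓝 (∑' n : ℕ, 1/(2*Real.pi*n) * (1/(2*Real.pi*n)))) := by
    apply tendsto_tsum_of_dominated_convergence (bound := fun n : ℕ => 3 * (1 / (n:ℝ)^2))
    · exact (Real.summable_one_div_nat_pow.2 (by norm_num)).mul_left 3
    · intro n
      rcases Nat.eq_zero_or_pos n with hn | hn
      · subst hn; simp [gQ]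
      · have h1 := (Z0_lim h0 hn (Nat.mul_pos hL hn)).add (leftN_lim hα hirr hn (L*n))
        have h2 := h1.const_mul (1/(2*Real.pi*n))
        rw [add_zero] at h2
        refine h2.congr ?_
        intro Q; unfold gQ; rw [add_div]
    · filter_upwards [tlog.eventually_ge_atTop 1] with Q hQ n
      exact gQ_bound hα hL hQ n
  have e : ∑' n : ℕ, 1/(2*Real.pi*(n:ℝ)) * (1/(2*Real.pi*n)) = 1/24 := by
    have h := hasSum_zeta_two.mul_left (1/(4*Real.pi^2))
    have h2 : (1/(4*Real.pi^2)) * (Real.pi^2/6) = 1/24 := by field_simp; norm_num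
    rw [h2] at h
    rw [← h.tsum_eq]
    apply tsum_congr
    intro n; 
    rcases Nat.eq_zero_or_pos n with hn | hn
    · subst hn; simp
    · field_simp; norm_num
  rw [e] at key
  refine key.congr ?_
  intro Q
  exact tsum_eq_sum (fun n hn => gQ_zero hL hn)

theorem Hs_lim {α : ℝ} (h0 : 0 < α) (hα : α ≤ 1) (hirr : Irrational α) :
    Tendsto (fun Q : ℕ => Hs α Q / ((Q:ℝ)^2 * Real.log Q)) atTop (𝓝 (1/24)) := by
  rw [Metric.tendsto_atTop']
  suffices h : ∀ ε > 0, ∀ᶠ Q : ℕ in atTop, |Hs α Q / ((Q:ℝ)^2 * Real.log Q) - 1/24| < ε by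
    intro ε hε
    obtain ⟨N, hN⟩ := eventually_atTop.1 (h ε hε)
    exact ⟨N, fun n hn => hN n hn.le⟩
  intro ε hε
  obtain ⟨L, hL⟩ := exists_nat_gt (max 2 (16/ε))
  have hL2 : (2:ℝ) < L := lt_of_le_of_lt (le_max_left _ _) hL
  have hLε : 16/ε < L := lt_of_le_of_lt (le_max_right _ _) hL
  have hL2' : 2 ≤ L := by exact_mod_cast hL2.le
  have hT : 0 < L^2 := by positivity
  have l1 := gQ_lim h0 hα hirr (show 1 ≤ L by omega)
  have l2 := tlog_inv (L * (2 + Real.log ((L^2:ℕ):ℝ)))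
  have l3 := tinv (4 * (L:ℝ))
  have l4 : Tendsto (fun Q : ℕ => |∑ n ∈ Finset.Icc 1 Q, gQ α L Q n - 1/24| +
      (L * (2 + Real.log ((L^2:ℕ):ℝ))) / Real.log Q + 4 * (L:ℝ) / Q) atTop (𝓝 0) := by
    have := (((l1.sub_const (1/24)).abs).add l2).add l3
    simpa using this
  filter_upwards [l4.eventually_lt_const (show (0:ℝ) < ε/2 by linarith), tlog.eventually_ge_atTop 1,
    eventually_gt_atTop 0] with Q hQ hl hQ0
  have hQ0' : (0:ℝ) < Q := by exact_mod_cast hQ0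
  set l := Real.log (Q:ℝ) with hldef
  have hD := partD α hL2' hT Q
  have hN : 0 < (Q:ℝ)^2 * l := by positivity
  have hG : ∑ n ∈ Finset.Icc 1 Q, gQ α L Q n = (∑ n ∈ Finset.Icc 1 Q, 1/(2*Real.pi*n) *
      (Zp α n 0 (L*n) Q + leftN α n (L*n) Q)) / ((Q:ℝ)^2 * l) := by
    unfold gQ
    rw [Finset.sum_div]
    apply Finset.sum_congr rfl
    intro n _; ring
  have hF : |∑ n ∈ Finset.Icc 1 Q, 1/(2*Real.pi*n) * Yn α L Q n - ∑ n ∈ Finset.Icc 1 Q, 1/(2*Real.pi*n) *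
      (Zp α n 0 (L*n) Q + leftN α n (L*n) Q)| ≤ (Q/L) * (Q * (1 + l)) := by
    rw [← Finset.sum_sub_distrib]
    refine (Finset.abs_sum_le_sum_abs _ _).trans ?_
    calc _ ≤ ∑ n ∈ Finset.Icc 1 Q, if n ∈ Finset.Icc 1 (Q/L) then (Q * (1 + l)) else 0 := by
          apply Finset.sum_le_sum
          intro n hn
          have hn1 := (Finset.mem_Icc.1 hn).1
          have hn' : (0:ℝ) < n := by exact_mod_cast hn1
          rw [← mul_sub, abs_mul, abs_of_pos (by positivity : 0 < 1/(2*Real.pi*n))]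
          split_ifs with h
          · calc _ ≤ 1/(2*Real.pi*n) * (n * (Q * (1 + l))) := by
                  gcongr; exact Yn_dec hα hn1 L Q
              _ = 1/(2*Real.pi) * (Q * (1 + l)) := by field_simp
              _ ≤ 1 * (Q * (1 + l)) := by
                  gcongr
                  rw [div_le_one (by positivity)]; linarith [Real.pi_gt_three]
              _ = _ := one_mul _
          · have h3 : Q < L * n := by
              rw [Finset.mem_Icc, Nat.le_div_iff_mul_le (by omega)] at h
              rw [mul_comm]
              by_contra h4
              exact h ⟨hn1, by omega⟩
            have : Yn α L Q n = 0 := by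
              unfold Yn; rw [Finset.Icc_eq_empty (by omega)]; simp
            rw [this, Zp_empty _ _ _ _ _ h3, leftN_empty _ _ _ _ h3]; simp
      _ = ∑ n ∈ (Finset.Icc 1 Q).filter (fun n => n ∈ Finset.Icc 1 (Q/L)), ((Q:ℝ) * (1 + l)) := by
          rw [Finset.sum_filter]
      _ ≤ ∑ n ∈ Finset.Icc 1 (Q/L), ((Q:ℝ) * (1 + l)) := by
          apply Finset.sum_le_sum_of_subset_of_nonneg
          · intro x hx; exact (Finset.mem_filter.1 hx).2
          · intros; positivity
      _ = ((Q/L:ℕ):ℝ) * (Q * (1 + l)) := by simp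
      _ ≤ _ := by gcongr; exact Nat.cast_div_le
  set A := ∑ n ∈ Finset.Icc 1 Q, 1/(2*Real.pi*n) * Yn α L Q n
  set B := ∑ n ∈ Finset.Icc 1 Q, 1/(2*Real.pi*n) * (Zp α n 0 (L*n) Q + leftN α n (L*n) Q)
  rw [hG] at hQ
  have e : Hs α Q / ((Q:ℝ)^2 * l) - 1/24 = (B / ((Q:ℝ)^2 * l) - 1/24) + (Hs α Q - A)/((Q:ℝ)^2 * l)
      + (A - B)/((Q:ℝ)^2 * l) := by ring
  rw [e]
  have b1 : |(Hs α Q - A)/((Q:ℝ)^2 * l)| ≤ 2/L + L * (2 + Real.log ((L^2:ℕ):ℝ)) / l + 4 * L/Q + 4/L := by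
    rw [abs_div, abs_of_pos hN, div_le_iff₀ hN]
    refine hD.trans ?_
    unfold Eb
    have hlT : 0 ≤ Real.log ((L^2:ℕ):ℝ) := Real.log_natCast_nonneg _
    rw [← hldef]
    calc (Q:ℝ) * (Q * (1 + l) / L^2 + L * (Q * (2 + Real.log ((L^2:ℕ):ℝ)) + 2 * (Q/((L^2:ℕ):ℝ) + 1) * (1 + l)))
        ≤ (Q:ℝ) * (Q * (l + l) / (L*1) + L * (Q * (2 + Real.log ((L^2:ℕ):ℝ)) + 2 * (Q/((L^2:ℕ):ℝ) + 1) * (l + l))) := by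
          rw [pow_two (L:ℝ)]
          gcongr
          linarith
      _ = _ := by push_cast; field_simp; ring
  have b2 : |(A - B)/((Q:ℝ)^2 * l)| ≤ 2/L := by
    rw [abs_div, abs_of_pos hN, div_le_iff₀ hN]
    refine hF.trans ?_
    calc (Q/L:ℝ) * (Q * (1 + l)) ≤ (Q/L:ℝ) * (Q * (l + l)) := by gcongr
      _ = _ := by field_simp; ring
  have b3 : (8:ℝ)/L < ε/2 := by
    rw [div_lt_iff₀ hε] at hLε
    rw [div_lt_iff₀ (by linarith)]; linarith
  have b4 : (8:ℝ)/L = 2/L + 4/L + 2/L := by ring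
  calc _ ≤ |B / ((Q:ℝ)^2 * l) - 1/24| + |(Hs α Q - A)/((Q:ℝ)^2 * l)| + |(A - B)/((Q:ℝ)^2 * l)| :=
        abs_add_three _ _ _
    _ < _ := by linarith

end

section
open Filter Topology


theorem sum_range_mul' (g : ℕ → ℝ) (w d : ℕ) :
    ∑ n ∈ Finset.range (w*d), g n = ∑ j ∈ Finset.range d, ∑ r ∈ Finset.range w, g (w*j+r) := by
  induction d with
  | zero => simp
  | succ d ih => rw [Nat.mul_succ, Finset.sum_range_add, ih, Finset.sum_range_succ]

theorem sum_range_cast (d : ℕ) : ∑ j ∈ Finset.range d, (j:ℝ) = d*(d-1)/2 := by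
  induction d with
  | zero => simp
  | succ d ih => rw [Finset.sum_range_succ, ih]; push_cast; ring

theorem saw_dist {w d r : ℕ} (hd : 0 < d) (hr : r < w) :
    ∑ j ∈ Finset.range d, saw (((w*j+r:ℕ):ℝ)/((w*d:ℕ):ℝ)) = saw ((r:ℝ)/w) := by
  have hw : (0:ℝ) < w := by exact_mod_cast (by omega : 0 < w)
  have hd' : (0:ℝ) < d := by exact_mod_cast hd
  have key : ∀ j ∈ Finset.range d, 0 < w*j+r →
      saw (((w*j+r:ℕ):ℝ)/((w*d:ℕ):ℝ)) = (j:ℝ)/d + r/(w*d) - 1/2 := by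
    intro j hj h
    rw [Finset.mem_range] at hj
    rw [saw_lt h]
    · push_cast; field_simp
    · calc w*j+r < w*j+w := by omega
        _ = w*(j+1) := by ring
        _ ≤ w*d := Nat.mul_le_mul_left _ hj
  rcases Nat.eq_zero_or_pos r with h0 | h0
  · subst h0
    obtain ⟨e, rfl⟩ : ∃ e, d = e+1 := ⟨d-1, by omega⟩
    rw [Finset.sum_range_succ']
    have : ∑ j ∈ Finset.range e, saw (((w*(j+1)+0:ℕ):ℝ)/((w*(e+1):ℕ):ℝ)) =
        ∑ j ∈ Finset.range e, (((j:ℝ)+1)/(e+1) - 1/2) := by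
      apply Finset.sum_congr rfl
      intro j hj
      rw [key (j+1) (by simpa using hj) (by have : 0 < w := by omega
                                            positivity)]
      push_cast; simp
    rw [this, Finset.sum_sub_distrib, ← Finset.sum_div, Finset.sum_add_distrib, sum_range_cast]
    simp [saw_zero]
    field_simp
    ring
  · rw [Finset.sum_congr rfl (fun j hj => key j hj (by omega)), saw_lt h0 hr,
      Finset.sum_sub_distrib, Finset.sum_add_distrib, ← Finset.sum_div, sum_range_cast]
    simp
    field_simp
    ring

theorem dedekind_range {w : ℕ} (hw : 0 < w) (v : ℕ) :
    dedekindSum v w = ∑ n ∈ Finset.range w, saw ((n:ℝ)/w) * saw ((n:ℝ)*v/w) := by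
  unfold dedekindSum
  have hw' : (0:ℝ) < w := by exact_mod_cast hw
  have e : Finset.Icc 1 ((w:ℤ).toNat) = Finset.Ico 1 (w+1) := by ext; simp
  have s1 : saw 1 = 0 := by
    have := saw_add_int 0 1
    simpa [saw_zero] using this
  rw [e, Finset.sum_Ico_succ_top (by omega)]
  obtain ⟨u, rfl⟩ : ∃ u, w = u+1 := ⟨w-1, by omega⟩
  rw [Finset.sum_range_succ', Finset.sum_Ico_eq_sum_range]
  simp only [Int.cast_natCast]
  rw [div_self hw'.ne', s1]
  simp [saw_zero, add_comm]

theorem dedekind_hom {w d : ℕ} (hw : 0 < w) (hd : 0 < d) (v : ℕ) :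
    dedekindSum ((d*v:ℕ):ℤ) ((d*w:ℕ):ℤ) = dedekindSum v w := by
  rw [dedekind_range (by positivity), dedekind_range hw, mul_comm d w, sum_range_mul',
    Finset.sum_comm]
  have hw' : (0:ℝ) < w := by exact_mod_cast hw
  have hd' : (0:ℝ) < d := by exact_mod_cast hd
  apply Finset.sum_congr rfl
  intro r hr
  rw [← saw_dist hd (Finset.mem_range.1 hr), Finset.sum_mul]
  apply Finset.sum_congr rfl
  intro j _
  congr 1
  have : ((w*j+r:ℕ):ℝ) * ((d*v:ℕ):ℝ) / ((w*d:ℕ):ℝ) = (r:ℝ)*v/w + ((j*v:ℕ):ℤ) := by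
    push_cast; field_simp; ring
  rw [this, saw_add_int]

theorem moebius_ind {g Q : ℕ} (hg : 0 < g) (hQ : g ≤ Q) :
    ∑ d ∈ (Finset.Icc 1 Q).filter (fun d => d ∣ g), ((ArithmeticFunction.moebius d : ℤ):ℝ)
      = if g = 1 then 1 else 0 := by
  have e : (Finset.Icc 1 Q).filter (fun d => d ∣ g) = g.divisors := by
    ext d
    simp only [Finset.mem_filter, Finset.mem_Icc, Nat.mem_divisors]
    constructor
    · rintro ⟨_, h⟩; exact ⟨h, by omega⟩
    · rintro ⟨h, _⟩
      exact ⟨⟨Nat.pos_of_dvd_of_pos h hg, (Nat.le_of_dvd hg h).trans hQ⟩, h⟩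
  rw [e]
  have h := congrArg (fun f => f g) ArithmeticFunction.moebius_mul_coe_zeta
  simp only [ArithmeticFunction.coe_mul_zeta_apply, ArithmeticFunction.one_apply] at h
  have h2 := congrArg (fun z : ℤ => (z:ℝ)) h
  push_cast at h2
  exact h2

noncomputable def TT (f : ℕ → ℕ → ℝ) (Q : ℕ) : ℝ :=
  ∑ w ∈ Finset.Icc 1 Q, ∑ v ∈ Finset.range w, f v w

noncomputable def GG (f : ℕ → ℕ → ℝ) (Q : ℕ) : ℝ :=
  ∑ w ∈ Finset.Icc 1 Q, ∑ v ∈ Finset.range w, if Nat.gcd v w = 1 then f v w else 0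

theorem TT_scale (f : ℕ → ℕ → ℝ) (hf : ∀ d v w, 0 < d → 0 < w → f (d*v) (d*w) = f v w)
    {d : ℕ} (hd : 0 < d) (Q : ℕ) :
    TT f (Q/d) = ∑ w ∈ Finset.Icc 1 Q, ∑ v ∈ Finset.range w,
      if d ∣ Nat.gcd v w then f v w else 0 := by
  unfold TT
  have e : ∀ w ∈ Finset.Icc 1 Q, (∑ v ∈ Finset.range w, if d ∣ Nat.gcd v w then f v w else 0)
      = if d ∣ w then ∑ v ∈ Finset.range (w/d), f v (w/d) else 0 := by
    intro w hw
    rw [Finset.mem_Icc] at hw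
    split_ifs with h
    · obtain ⟨u, rfl⟩ := h
      rw [Nat.mul_div_cancel_left _ hd, ← Finset.sum_filter]
      symm
      apply Finset.sum_nbij' (fun v => d*v) (fun v => v/d)
      · intro v hv
        rw [Finset.mem_range] at hv
        rw [Finset.mem_filter, Finset.mem_range]
        exact ⟨Nat.mul_lt_mul_of_pos_left hv hd, Nat.dvd_gcd (Dvd.intro _ rfl) (Dvd.intro _ rfl)⟩
      · intro v hv
        rw [Finset.mem_filter, Finset.mem_range] at hv
        rw [Finset.mem_range]
        exact Nat.div_lt_of_lt_mul hv.1
      · intro v _; exact Nat.mul_div_cancel_left _ hd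
      · intro v hv
        rw [Finset.mem_filter] at hv
        exact Nat.mul_div_cancel' (hv.2.trans (Nat.gcd_dvd_left _ _))
      · intro v _
        exact (hf d v u hd (by rcases Nat.eq_zero_or_pos u with h | h
                               · subst h; omega
                               · exact h)).symm
    · apply Finset.sum_eq_zero
      intro v _
      rw [if_neg (fun h' => h (h'.trans (Nat.gcd_dvd_right _ _)))]
  rw [Finset.sum_congr rfl e, ← Finset.sum_filter]
  apply Finset.sum_nbij' (fun v => d*v) (fun v => v/d)
  · intro w hw
    rw [Finset.mem_Icc] at hw
    rw [Finset.mem_filter, Finset.mem_Icc]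
    refine ⟨⟨Nat.mul_pos hd hw.1, ?_⟩, Dvd.intro _ rfl⟩
    rw [mul_comm]; exact (Nat.le_div_iff_mul_le hd).1 hw.2
  · intro w hw
    rw [Finset.mem_filter, Finset.mem_Icc] at hw
    rw [Finset.mem_Icc]
    exact ⟨Nat.div_pos (Nat.le_of_dvd hw.1.1 hw.2) hd, Nat.div_le_div_right hw.1.2⟩
  · intro v _; exact Nat.mul_div_cancel_left _ hd
  · intro v hv
    rw [Finset.mem_filter] at hv
    exact Nat.mul_div_cancel' hv.2
  · intro v _
    rw [Nat.mul_div_cancel_left _ hd]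

theorem GG_moebius (f : ℕ → ℕ → ℝ) (hf : ∀ d v w, 0 < d → 0 < w → f (d*v) (d*w) = f v w) (Q : ℕ) :
    GG f Q = ∑ d ∈ Finset.Icc 1 Q, ((ArithmeticFunction.moebius d : ℤ):ℝ) * TT f (Q/d) := by
  have e : ∀ d ∈ Finset.Icc 1 Q, ((ArithmeticFunction.moebius d : ℤ):ℝ) * TT f (Q/d) =
      ∑ w ∈ Finset.Icc 1 Q, ∑ v ∈ Finset.range w,
      (if d ∣ Nat.gcd v w then ((ArithmeticFunction.moebius d : ℤ):ℝ) else 0) * f v w := by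
    intro d hd
    rw [TT_scale f hf (Finset.mem_Icc.1 hd).1, Finset.mul_sum]
    apply Finset.sum_congr rfl
    intro w _
    rw [Finset.mul_sum]
    apply Finset.sum_congr rfl
    intro v _
    split_ifs <;> simp
  rw [Finset.sum_congr rfl e, Finset.sum_comm]
  unfold GG
  apply Finset.sum_congr rfl
  intro w hw
  rw [Finset.mem_Icc] at hw
  rw [Finset.sum_comm]
  apply Finset.sum_congr rfl
  intro v _
  have hg : 0 < Nat.gcd v w := Nat.gcd_pos_of_pos_right _ hw.1
  rw [← Finset.sum_mul, ← Finset.sum_filter,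
    moebius_ind hg ((Nat.gcd_le_right _ hw.1).trans hw.2)]
  split_ifs <;> simp

end

section
open Filter Topology


theorem mem_farey {Q : ℕ} {x : ℚ} : x ∈ farey Q ↔ 0 ≤ x ∧ x ≤ 1 ∧ x.den ≤ Q := by
  unfold farey
  simp only [Finset.mem_biUnion, Finset.mem_image, Finset.mem_Icc]
  constructor
  · rintro ⟨w, hw, v, hv, rfl⟩
    have hw' : (0:ℚ) < w := by exact_mod_cast hw.1
    refine ⟨by positivity, ?_, ?_⟩
    · rw [div_le_one hw']; exact_mod_cast hv.2
    · have h := Rat.den_dvd (v:ℤ) (w:ℤ)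
      rw [Rat.divInt_eq_div] at h
      simp only [Int.cast_natCast] at h
      have h2 : ((v:ℚ)/(w:ℚ)).den ∣ w := Int.natCast_dvd_natCast.1 h
      exact (Nat.le_of_dvd hw.1 h2).trans hw.2
  · rintro ⟨h0, h1, h2⟩
    have hn : 0 ≤ x.num := Rat.num_nonneg.2 h0
    have e : ((x.num.toNat:ℕ):ℚ) = (x.num:ℚ) := by
      exact_mod_cast congrArg (fun z : ℤ => (z:ℚ)) (Int.toNat_of_nonneg hn)
    refine ⟨x.den, ⟨x.den_pos, h2⟩, x.num.toNat, ⟨Nat.zero_le _, ?_⟩, ?_⟩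
    · have h := (Rat.le_iff x 1).1 h1
      simp at h
      omega
    · rw [e, Rat.num_div_den]

theorem cop_num {v w : ℕ} (hw : 0 < w) (h : Nat.gcd v w = 1) :
    ((v:ℚ)/(w:ℚ)).num = v ∧ ((v:ℚ)/(w:ℚ)).den = w := by
  have hw' : (0:ℤ) < w := by exact_mod_cast hw
  have h1 := Rat.num_div_eq_of_coprime (a := (v:ℤ)) hw' (by simpa using h)
  have h2 := Rat.den_div_eq_of_coprime (a := (v:ℤ)) hw' (by simpa using h)
  push_cast at h1 h2
  exact ⟨h1, by exact_mod_cast h2⟩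

theorem sum_farey {Q : ℕ} (hQ : 1 ≤ Q) (h : ℚ → ℝ) :
    ∑ x ∈ farey Q, h x = h 1 + ∑ w ∈ Finset.Icc 1 Q, ∑ v ∈ Finset.range w,
      if Nat.gcd v w = 1 then h ((v:ℚ)/(w:ℚ)) else 0 := by
  have m1 : (1:ℚ) ∈ farey Q := mem_farey.2 ⟨by norm_num, le_refl _, by simpa using hQ⟩
  rw [← Finset.add_sum_erase _ _ m1]
  congr 1
  simp only [← Finset.sum_filter]
  rw [Finset.sum_sigma']
  apply Finset.sum_nbij' (fun x => (⟨x.den, x.num.toNat⟩ : Σ _ : ℕ, ℕ)) (fun p => (p.2:ℚ)/(p.1:ℚ))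
  · intro x hx
    rw [Finset.mem_erase, mem_farey] at hx
    obtain ⟨hne, h0, h1, h2⟩ := hx
    have hn : 0 ≤ x.num := Rat.num_nonneg.2 h0
    simp only [Finset.mem_sigma, Finset.mem_Icc, Finset.mem_filter, Finset.mem_range]
    refine ⟨⟨x.den_pos, h2⟩, ?_, ?_⟩
    · have h := (Rat.lt_iff x 1).1 (lt_of_le_of_ne h1 hne)
      simp at h
      omega
    · have := x.reduced
      rw [show x.num.toNat = x.num.natAbs by omega]
      exact this
  · rintro ⟨w, v⟩ hp
    simp only [Finset.mem_sigma, Finset.mem_Icc, Finset.mem_filter, Finset.mem_range] at hp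
    obtain ⟨⟨hw, hwQ⟩, hv, hg⟩ := hp
    have hw' : (0:ℚ) < w := by exact_mod_cast hw
    have hl : (v:ℚ)/(w:ℚ) < 1 := by rw [div_lt_one hw']; exact_mod_cast hv
    rw [Finset.mem_erase, mem_farey]
    refine ⟨hl.ne, by positivity, hl.le, ?_⟩
    rw [(cop_num hw hg).2]; exact hwQ
  · intro x hx
    rw [Finset.mem_erase, mem_farey] at hx
    obtain ⟨hne, h0, h1, h2⟩ := hx
    have hn : 0 ≤ x.num := Rat.num_nonneg.2 h0
    have e : ((x.num.toNat:ℕ):ℚ) = (x.num:ℚ) := by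
      exact_mod_cast congrArg (fun z : ℤ => (z:ℚ)) (Int.toNat_of_nonneg hn)
    simp only [e, Rat.num_div_den]
  · rintro ⟨w, v⟩ hp
    simp only [Finset.mem_sigma, Finset.mem_Icc, Finset.mem_filter, Finset.mem_range] at hp
    obtain ⟨⟨hw, hwQ⟩, hv, hg⟩ := hp
    obtain ⟨a, b⟩ := cop_num hw hg
    simp only [a, b, Int.toNat_natCast]
  · intro x hx
    rw [Finset.mem_erase, mem_farey] at hx
    obtain ⟨hne, h0, h1, h2⟩ := hx
    have hn : 0 ≤ x.num := Rat.num_nonneg.2 h0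
    have e : ((x.num.toNat:ℕ):ℚ) = (x.num:ℚ) := by
      exact_mod_cast congrArg (fun z : ℤ => (z:ℚ)) (Int.toNat_of_nonneg hn)
    simp only [e, Rat.num_div_den]

open Classical in
noncomputable def fa (α : ℝ) (v w : ℕ) : ℝ := if (v:ℝ) < α * w then dedekindSum v w else 0

theorem fa_hom (α : ℝ) (d v w : ℕ) (hd : 0 < d) (hw : 0 < w) : fa α (d*v) (d*w) = fa α v w := by
  unfold fa
  rw [dedekind_hom hw hd]
  have hd' : (0:ℝ) < d := by exact_mod_cast hd
  have : (((d*v:ℕ):ℝ) < α * ((d*w:ℕ):ℝ)) ↔ ((v:ℝ) < α * w) := by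
    push_cast
    rw [show α * ((d:ℝ)*w) = d * (α * w) by ring]
    exact mul_lt_mul_iff_right₀ hd'
  simp only [this]

theorem TT_fa (α : ℝ) (Q : ℕ) : TT (fa α) Q = Hs α Q := by
  unfold TT Hs fa vset
  simp only [Finset.sum_filter]

theorem TT_one (Q : ℕ) : TT (fun _ _ => 1) Q = Q*(Q+1)/2 := by
  unfold TT
  simp [sum_id_Icc]

open scoped Classical in
theorem farey_fa {Q : ℕ} (hQ : 1 ≤ Q) {α : ℝ} (hα : α ≤ 1) :
    ∑ x ∈ (farey Q).filter (fun x : ℚ => (x : ℝ) < α), sQ x = GG (fa α) Q := by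
  rw [Finset.sum_filter, sum_farey hQ, if_neg (by push_cast; linarith), zero_add]
  unfold GG
  apply Finset.sum_congr rfl
  intro w hw
  rw [Finset.mem_Icc] at hw
  have hw' : (0:ℝ) < w := by exact_mod_cast hw.1
  apply Finset.sum_congr rfl
  intro v _
  split_ifs with hg h h
  · obtain ⟨a, b⟩ := cop_num hw.1 hg
    unfold fa sQ
    rw [a, b, if_pos]
    push_cast at h
    rwa [div_lt_iff₀ hw'] at h
  · unfold fa
    rw [if_neg]
    push_cast at h
    rwa [div_lt_iff₀ hw'] at h
  · rfl

theorem farey_card {Q : ℕ} (hQ : 1 ≤ Q) : ((farey Q).card : ℝ) = 1 + GG (fun _ _ => 1) Q := by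
  have := sum_farey hQ (fun _ => (1:ℝ))
  simp only [Finset.sum_const, nsmul_eq_mul, mul_one] at this
  rw [this]; rfl

end

section
open Filter Topology


theorem tdiv {d : ℕ} (hd : 0 < d) : Tendsto (fun Q : ℕ => Q / d) atTop atTop :=
  Nat.tendsto_div_const_atTop hd.ne'

theorem tdiv_ratio {d : ℕ} (hd : 0 < d) :
    Tendsto (fun Q : ℕ => ((Q/d:ℕ):ℝ)/Q) atTop (𝓝 (1/d)) := by
  have hd' : (0:ℝ) < d := by exact_mod_cast hd
  have h1 : Tendsto (fun Q : ℕ => (1:ℝ)/d - 1/(Q:ℝ)) atTop (𝓝 (1/d - 0)) :=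
    tendsto_const_nhds.sub (tinv 1)
  rw [sub_zero] at h1
  refine tendsto_of_tendsto_of_tendsto_of_le_of_le' h1 tendsto_const_nhds ?_ ?_
  · filter_upwards [eventually_ge_atTop 1] with Q hQ
    have hQ' : (0:ℝ) < Q := by exact_mod_cast hQ
    have h : Q < d * (Q/d) + d := by
      have := Nat.div_add_mod Q d
      have := Nat.mod_lt Q hd
      omega
    have h' : (Q:ℝ) < d * ((Q/d:ℕ):ℝ) + d := by exact_mod_cast h
    rw [div_sub_div _ _ hd'.ne' hQ'.ne', div_le_div_iff₀ (by positivity) hQ']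
    nlinarith
  · filter_upwards [eventually_ge_atTop 1] with Q hQ
    have hQ' : (0:ℝ) < Q := by exact_mod_cast hQ
    have h : ((Q/d:ℕ):ℝ) ≤ (Q:ℝ)/d := Nat.cast_div_le
    rw [div_le_div_iff₀ hQ' hd']
    rw [le_div_iff₀ hd'] at h
    linarith

theorem tdiv_log {d : ℕ} (hd : 0 < d) :
    Tendsto (fun Q : ℕ => Real.log ((Q/d:ℕ):ℝ)/Real.log Q) atTop (𝓝 1) := by
  have hd' : (0:ℝ) < d := by exact_mod_cast hd
  have h1 : Tendsto (fun Q : ℕ => Real.log (((Q/d:ℕ):ℝ)/Q)) atTop (𝓝 (Real.log (1/d))) :=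
    (Real.continuousAt_log (by positivity)).tendsto.comp (tdiv_ratio hd)
  have h2 := (tendsto_const_nhds (x := (1:ℝ))).add (h1.mul (tlog_inv 1))
  rw [mul_zero, add_zero] at h2
  refine h2.congr' ?_
  filter_upwards [eventually_ge_atTop d, eventually_ge_atTop 1, tlog.eventually_ge_atTop 1] with Q hQ hQ1 hl
  have hQ' : (0:ℝ) < Q := by exact_mod_cast hQ1
  have hN : (0:ℝ) < ((Q/d:ℕ):ℝ) := by exact_mod_cast Nat.div_pos hQ hd
  rw [Real.log_div hN.ne' hQ'.ne']
  have : Real.log (Q:ℝ) ≠ 0 := by linarith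
  field_simp
  ring

noncomputable def aa (α : ℝ) (Q d : ℕ) : ℝ :=
  if d ∈ Finset.Icc 1 Q then ((ArithmeticFunction.moebius d : ℤ):ℝ) *
    ((Hs α (Q/d) - 1/12 * Real.log Q * (((Q/d:ℕ):ℝ)*(((Q/d:ℕ):ℝ)+1)/2)) / ((Q:ℝ)^2 * Real.log Q))
  else 0

theorem aa_lim {α : ℝ} (h0 : 0 < α) (hα : α ≤ 1) (hirr : Irrational α) (d : ℕ) :
    Tendsto (fun Q => aa α Q d) atTop (𝓝 0) := by
  rcases Nat.eq_zero_or_pos d with hd | hd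
  · subst hd; simp [aa]
  have hd' : (0:ℝ) < d := by exact_mod_cast hd
  have l1 := (Hs_lim h0 hα hirr).comp (tdiv hd)
  have l2 := tdiv_ratio hd
  have l3 := tdiv_log hd
  have l4 := (((l1.mul (l2.pow 2)).mul l3).sub
    ((l2.mul (l2.add (tinv 1))).const_mul (1/24))).const_mul ((ArithmeticFunction.moebius d : ℤ):ℝ)
  have e : ((ArithmeticFunction.moebius d : ℤ):ℝ) *
    (1/24 * (1/(d:ℝ))^2 * 1 - 1/24 * (1/(d:ℝ) * (1/(d:ℝ) + 0))) = 0 := by ring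
  rw [e] at l4
  refine l4.congr' ?_
  filter_upwards [eventually_ge_atTop (2*d), eventually_ge_atTop 1, tlog.eventually_ge_atTop 1] with Q hQ hQ1 hl
  have hQ' : (0:ℝ) < Q := by exact_mod_cast hQ1
  have hN2 : 2 ≤ Q/d := (Nat.le_div_iff_mul_le hd).2 hQ
  have hN : (0:ℝ) < ((Q/d:ℕ):ℝ) := by exact_mod_cast (by omega : 0 < Q/d)
  have hlN : 0 < Real.log ((Q/d:ℕ):ℝ) := Real.log_pos (by exact_mod_cast (by omega : 1 < Q/d))
  have hlQ : 0 < Real.log (Q:ℝ) := by linarith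
  unfold aa
  rw [if_pos (Finset.mem_Icc.2 ⟨hd, by omega⟩)]
  congr 1
  simp only [Function.comp]
  generalize ((Q/d:ℕ):ℝ) = N at *
  generalize Real.log N = x at *
  generalize Real.log (Q:ℝ) = y at *
  field_simp
  ring

theorem Hs_zero (α : ℝ) : Hs α 0 = 0 := by unfold Hs; simp

theorem Hs_one (α : ℝ) : Hs α 1 = 0 := by
  unfold Hs
  simp only [Finset.Icc_self, Finset.sum_singleton]
  apply Finset.sum_eq_zero
  intro v _
  rw [dedekind_range (by norm_num)]
  simp [saw_zero]

theorem Hs_bound {α : ℝ} (h0 : 0 < α) (hα : α ≤ 1) (hirr : Irrational α) :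
    ∃ C : ℝ, 0 ≤ C ∧ ∀ N Q : ℕ, N ≤ Q → |Hs α N| ≤ C * (N:ℝ)^2 * Real.log Q := by
  obtain ⟨C, hC⟩ := (Metric.isBounded_range_of_tendsto _ (Hs_lim h0 hα hirr)).exists_norm_le
  refine ⟨|C|, abs_nonneg _, ?_⟩
  intro N Q hNQ
  have hlQ : 0 ≤ Real.log (Q:ℝ) := Real.log_natCast_nonneg Q
  rcases Nat.lt_or_ge N 2 with h | h
  · have : Hs α N = 0 := by
      interval_cases N
      · exact Hs_zero α
      · exact Hs_one α
    rw [this, abs_zero]; positivity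
  · have h1 := hC _ (Set.mem_range_self N)
    have hN : (0:ℝ) < N := by exact_mod_cast (by omega : 0 < N)
    have hl : 0 < Real.log (N:ℝ) := Real.log_pos (by exact_mod_cast h)
    rw [Real.norm_eq_abs, abs_div, abs_of_pos (a := (N:ℝ)^2 * Real.log N) (by positivity),
      div_le_iff₀ (by positivity)] at h1
    have h2 : Real.log (N:ℝ) ≤ Real.log Q := Real.log_le_log hN (by exact_mod_cast hNQ)
    calc |Hs α N| ≤ C * ((N:ℝ)^2 * Real.log N) := h1
      _ ≤ |C| * ((N:ℝ)^2 * Real.log Q) := by gcongr; exact le_abs_self C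
      _ = _ := by ring

theorem aa_bound {α C : ℝ} (hC0 : 0 ≤ C) (hC : ∀ N Q : ℕ, N ≤ Q → |Hs α N| ≤ C * (N:ℝ)^2 * Real.log Q)
    {Q : ℕ} (hl : 1 ≤ Real.log (Q:ℝ)) (d : ℕ) : ‖aa α Q d‖ ≤ (C + 1) * (1 / (d:ℝ)^2) := by
  unfold aa
  split_ifs with h
  swap
  · rw [norm_zero]; positivity
  rw [Finset.mem_Icc] at h
  have hd' : (0:ℝ) < d := by exact_mod_cast h.1
  have hQ' : (0:ℝ) < Q := by exact_mod_cast (by omega : 0 < Q)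
  have hm : |((ArithmeticFunction.moebius d : ℤ):ℝ)| ≤ 1 := by
    exact_mod_cast ArithmeticFunction.abs_moebius_le_one (n := d)
  have hNd : ((Q/d:ℕ):ℝ) ≤ (Q:ℝ)/d := Nat.cast_div_le
  have hN1 : (1:ℝ) ≤ ((Q/d:ℕ):ℝ) := by exact_mod_cast Nat.div_pos h.2 h.1
  have hb := hC (Q/d) Q (Nat.div_le_self _ _)
  have hsq : ((Q/d:ℕ):ℝ)^2 ≤ ((Q:ℝ)/d)^2 := by gcongr
  generalize ((Q/d:ℕ):ℝ) = N at *
  rw [Real.norm_eq_abs, abs_mul, abs_div, abs_of_pos (a := (Q:ℝ)^2 * Real.log Q) (by positivity)]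
  have h1 : |Hs α (Q/d) - 1/12 * Real.log Q * (N*(N+1)/2)| ≤ (C+1) * ((Q:ℝ)/d)^2 * Real.log Q := by
    calc _ ≤ |Hs α (Q/d)| + |1/12 * Real.log Q * (N*(N+1)/2)| := abs_sub _ _
      _ ≤ C * N^2 * Real.log Q + N^2 * Real.log Q := by
          rw [abs_of_nonneg (a := 1/12 * Real.log Q * (N*(N+1)/2)) (by positivity)]
          have : 1/12 * Real.log Q * (N*(N+1)/2) ≤ N^2 * Real.log Q := by
            have : (N*(N+1)/2) * (1/12) ≤ N^2 := by nlinarith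
            calc _ = (N*(N+1)/2) * (1/12) * Real.log Q := by ring
              _ ≤ _ := by gcongr
          linarith
      _ = (C+1) * N^2 * Real.log Q := by ring
      _ ≤ _ := by gcongr
  calc _ ≤ 1 * ((C+1) * ((Q:ℝ)/d)^2 * Real.log Q / ((Q:ℝ)^2 * Real.log Q)) := by gcongr
    _ = _ := by
      have : Real.log (Q:ℝ) ≠ 0 := by linarith
      field_simp

theorem diff_lim {α : ℝ} (h0 : 0 < α) (hα : α ≤ 1) (hirr : Irrational α) :
    Tendsto (fun Q : ℕ => (GG (fa α) Q - 1/12 * Real.log Q * GG (fun _ _ => 1) Q) /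
      ((Q:ℝ)^2 * Real.log Q)) atTop (𝓝 0) := by
  obtain ⟨C, hC0, hC⟩ := Hs_bound h0 hα hirr
  have hs : Summable (fun d : ℕ => (C+1) * (1/(d:ℝ)^2)) :=
    (Real.summable_one_div_nat_pow.2 (by norm_num)).mul_left _
  have h := tendsto_tsum_of_dominated_convergence (𝓕 := atTop) (f := fun Q d => aa α Q d)
    (g := fun _ => (0:ℝ)) hs (fun d => aa_lim h0 hα hirr d)
    (by filter_upwards [tlog.eventually_ge_atTop 1] with Q hl d using aa_bound hC0 hC hl d)
  rw [tsum_zero] at h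
  refine h.congr ?_
  intro Q
  rw [tsum_eq_sum (s := Finset.Icc 1 Q) (fun d hd => by unfold aa; rw [if_neg hd]),
    GG_moebius _ (fa_hom α), GG_moebius _ (fun _ _ _ _ _ => rfl), Finset.mul_sum,
    ← Finset.sum_sub_distrib, Finset.sum_div]
  apply Finset.sum_congr rfl
  intro d hd
  unfold aa
  rw [if_pos hd, TT_fa, TT_one]
  ring

theorem sum_sq_le {Q : ℕ} (hQ : 2 ≤ Q) : ∑ d ∈ Finset.Icc 2 Q, 1/(d:ℝ)^2 ≤ 3/4 - 1/(Q:ℝ) := by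
  induction Q, hQ using Nat.le_induction with
  | base => norm_num
  | succ n hn ih =>
    rw [Finset.sum_Icc_succ_top (by omega)]
    have hn' : (0:ℝ) < n := by exact_mod_cast (by omega : 0 < n)
    have : 1/((n+1:ℕ):ℝ)^2 ≤ 1/n - 1/((n+1:ℕ):ℝ) := by
      push_cast
      rw [div_sub_div _ _ hn'.ne' (by positivity), div_le_div_iff₀ (by positivity) (by positivity)]
      nlinarith
    linarith

theorem phi_lower {Q : ℕ} (hQ : 2 ≤ Q) :
    (Q:ℝ)^2/8 - Q * (1 + Real.log Q) / 2 ≤ GG (fun _ _ => 1) Q := by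
  rw [GG_moebius _ (fun _ _ _ _ _ => rfl), ← Finset.add_sum_Ioc_eq_sum_Icc (by omega : 1 ≤ Q)]
  have e : Finset.Ioc 1 Q = Finset.Icc 2 Q := by ext; simp; omega
  rw [e, Nat.div_one, ArithmeticFunction.moebius_apply_one, TT_one]
  have hQ' : (0:ℝ) < Q := by exact_mod_cast (by omega : 0 < Q)
  have h1 : ∀ d ∈ Finset.Icc 2 Q, -((Q:ℝ)^2/2 * (1/(d:ℝ)^2) + Q/2 * (1/(d:ℝ))) ≤
      ((ArithmeticFunction.moebius d : ℤ):ℝ) * TT (fun _ _ => 1) (Q/d) := by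
    intro d hd
    rw [Finset.mem_Icc] at hd
    have hd' : (0:ℝ) < d := by exact_mod_cast (by omega : 0 < d)
    have hm : |((ArithmeticFunction.moebius d : ℤ):ℝ)| ≤ 1 := by
      exact_mod_cast ArithmeticFunction.abs_moebius_le_one (n := d)
    have hm' := (abs_le.1 hm).1
    have hNd : ((Q/d:ℕ):ℝ) ≤ (Q:ℝ)/d := Nat.cast_div_le
    have hN0 : (0:ℝ) ≤ ((Q/d:ℕ):ℝ) := Nat.cast_nonneg _
    rw [TT_one]
    generalize ((Q/d:ℕ):ℝ) = N at *
    have : N*(N+1)/2 ≤ (Q:ℝ)/d*((Q:ℝ)/d+1)/2 := by gcongr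
    have e : (Q:ℝ)/d*((Q:ℝ)/d+1)/2 = (Q:ℝ)^2/2 * (1/(d:ℝ)^2) + Q/2 * (1/(d:ℝ)) := by
      field_simp
    have h0 : 0 ≤ N*(N+1)/2 := by positivity
    nlinarith
  have h2 := Finset.sum_le_sum h1
  rw [Finset.sum_neg_distrib, Finset.sum_add_distrib, ← Finset.mul_sum, ← Finset.mul_sum] at h2
  have h3 := sum_sq_le hQ
  have h4 : ∑ d ∈ Finset.Icc 2 Q, 1/(d:ℝ) ≤ 1 + Real.log Q := by
    refine le_trans ?_ (hsum_le Q)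
    apply Finset.sum_le_sum_of_subset_of_nonneg
    · intro d hd; rw [Finset.mem_Icc] at *; omega
    · intros; positivity
  have h5 : (Q:ℝ)^2/2 * (∑ d ∈ Finset.Icc 2 Q, 1/(d:ℝ)^2) ≤ (Q:ℝ)^2/2 * (3/4) := by
    gcongr
    have : 0 < 1/(Q:ℝ) := by positivity
    linarith
  have h6 : (Q:ℝ)/2 * (∑ d ∈ Finset.Icc 2 Q, 1/(d:ℝ)) ≤ (Q:ℝ)/2 * (1 + Real.log Q) := by gcongr
  push_cast
  nlinarith

theorem phi_ev : ∀ᶠ Q : ℕ in atTop, (Q:ℝ)^2/16 ≤ GG (fun _ _ => 1) Q := by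
  have h1 : Tendsto (fun Q : ℕ => 1/(Q:ℝ) + Real.log Q/Q) atTop (𝓝 (0+0)) := by
    apply (tinv 1).add
    exact (Real.isLittleO_log_id_atTop.tendsto_div_nhds_zero).comp tendsto_natCast_atTop_atTop
  rw [add_zero] at h1
  filter_upwards [h1.eventually (ge_mem_nhds (show (0:ℝ) < 1/8 by norm_num)), eventually_ge_atTop 2] with Q h hQ
  have hQ' : (0:ℝ) < Q := by exact_mod_cast (by omega : 0 < Q)
  refine le_trans ?_ (phi_lower hQ)
  rw [← add_div, div_le_iff₀ hQ'] at h
  nlinarith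

open scoped Classical in
theorem main_irr {α : ℝ} (h0 : 0 < α) (hα : α ≤ 1) (hirr : Irrational α) :
    Filter.Tendsto
        (fun Q : ℕ =>
          ((1 / ((farey Q).card : ℝ)) *
              (∑ x ∈ (farey Q).filter (fun x : ℚ => (x : ℝ) < α), sQ x)
            - 1/12 * Real.log Q) / Real.log Q)
        Filter.atTop (nhds 0) := by
  have l1 := (diff_lim h0 hα hirr).abs
  have l2 : Tendsto (fun Q : ℕ => 1/(Q:ℝ) * (1/(Q:ℝ))) atTop (𝓝 (0*0)) := (tinv 1).mul (tinv 1)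
  have l3 := (l1.add l2).const_mul 16
  rw [abs_zero, mul_zero, add_zero, mul_zero] at l3
  refine squeeze_zero_norm' ?_ l3
  filter_upwards [phi_ev, eventually_ge_atTop 1, tlog.eventually_ge_atTop 1] with Q hφ hQ hl
  have hQ' : (0:ℝ) < Q := by exact_mod_cast hQ
  rw [farey_fa hQ hα, farey_card hQ]
  generalize GG (fun _ _ => 1) Q = F at *
  generalize GG (fa α) Q = G at *
  have hlp : 0 < Real.log (Q:ℝ) := by linarith
  generalize Real.log (Q:ℝ) = y at *
  have hF : (Q:ℝ)^2/16 ≤ 1 + F := by linarith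
  have hF0 : 0 < 1 + F := lt_of_lt_of_le (by positivity) hF
  have e : (1/(1+F) * G - 1/12*y)/y = ((G - 1/12*y*F) - 1/12*y)/((1+F)*y) := by
    field_simp
    ring
  rw [e, Real.norm_eq_abs, abs_div, abs_of_pos (a := (1+F)*y) (by positivity), abs_div,
    abs_of_pos (a := (Q:ℝ)^2*y) (by positivity)]
  calc _ ≤ (|G - 1/12*y*F| + y)/((Q:ℝ)^2/16*y) := by
        gcongr
        refine (abs_sub _ _).trans ?_
        rw [abs_of_pos (a := 1/12*y) (by positivity)]
        linarith
    _ = _ := by field_simp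


end

open scoped Classical in
/-- **Theorem 1.2.** There is a full-measure set `S ⊆ [0,1/2]` such that for every `α ∈ S`,
the average over the Farey fractions of order `Q` in `[0,α)` of the Dedekind sum is
`(1/12) log Q + o_α(log Q)` as `Q → ∞`. -/
theorem dedekind_sum_average_ae_irrational_cut :
    ∃ S : Set ℝ, S ⊆ Set.Icc 0 (1/2) ∧
      MeasureTheory.volume (Set.Icc (0:ℝ) (1/2) \ S) = 0 ∧
      ∀ α ∈ S, Filter.Tendsto
        (fun Q : ℕ =>
          ((1 / ((farey Q).card : ℝ)) *
              (∑ x ∈ (farey Q).filter (fun x : ℚ => (x : ℝ) < α), sQ x)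
            - 1/12 * Real.log Q) / Real.log Q)
        Filter.atTop (nhds 0) := by
  refine ⟨{α | α ∈ Set.Icc (0:ℝ) (1/2) ∧ Irrational α}, fun α h => h.1, ?_, ?_⟩
  · apply Set.Countable.measure_zero
    refine (Set.countable_range (fun q : ℚ => (q:ℝ))).mono ?_
    rintro x ⟨hx, hn⟩
    by_contra h
    exact hn ⟨hx, h⟩
  · rintro α ⟨hI, hirr⟩
    have h0 : α ≠ 0 := hirr.ne_zero
    exact main_irr (lt_of_le_of_ne hI.1 h0.symm) (by linarith [hI.2]) hirr
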